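/- Under hypotheses (H1), (H2) and (H3), if η is a g-invariant Borel probability measure with h_η(g) = h_top(g), then η is absolutely continuous with respect to the accumulation point ν of (ν_n), and in fact η = ν. -/

import Mathlib

open MeasureTheory Filter Topology Set
open scoped ENNReal NNReal

namespace Samva

variable {X : Type*}

/-- The `n`-th iterate (`n : ℤ`) of a homeomorphism. -/
noncomputable def zIter [TopologicalSpace X] (f : X ≃ₜ X) : ℤ → X → X
  | Int.ofNat n => (f : X → X)^[n]
  | Int.negSucc n => (f.symm : X → X)^[n + 1]

/-- `f` is expansive with expansivity constant `α`. -/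
def IsExpansiveWith [PseudoMetricSpace X] (f : X ≃ₜ X) (α : ℝ) : Prop :=
  0 < α ∧ ∀ x y : X, (∀ n : ℤ, dist (zIter f n x) (zIter f n y) ≤ α) → x = y

/-- `f` is expansive. -/
def IsExpansive [PseudoMetricSpace X] (f : X ≃ₜ X) : Prop :=
  ∃ α : ℝ, IsExpansiveWith f α

/-- The (periodic) specification property. -/
def HasSpecification [PseudoMetricSpace X] (f : X ≃ₜ X) : Prop :=
  ∀ ε : ℝ, 0 < ε → ∃ M : ℕ, ∀ (k : ℕ) (x : Fin (k + 1) → X) (a b : Fin (k + 1) → ℤ),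
    (∀ i, a i ≤ b i) →
    (∀ i : Fin k, (M : ℤ) ≤ a i.succ - b i.castSucc) →
    ∀ p : ℤ, (M : ℤ) + b (Fin.last k) - a 0 ≤ p →
      ∃ z : X, zIter f p z = z ∧
        ∀ i, ∀ j : ℤ, a i ≤ j → j ≤ b i → dist (zIter f j z) (zIter f j (x i)) ≤ ε

/-- The set of `n`-periodic points. -/
def perSet (f : X → X) (n : ℕ) : Set X := {x | f^[n] x = x}

/-- The uniform (equidistributed) probability measure on the `n`-periodic points of `f`,
`μ_n = |Per_n(f)|⁻¹ ∑_{x ∈ Per_n(f)} δ_x`. -/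
noncomputable def perMeasure [MeasurableSpace X] (f : X → X) (n : ℕ) : Measure X :=
  ProbabilityTheory.uniformOn (perSet f n)

/-- The uniform probability measure on a set `s`,
`|s|⁻¹ ∑_{x ∈ s} δ_x`. -/
noncomputable def unifMeasure [MeasurableSpace X] (s : Set X) : Measure X :=
  ProbabilityTheory.uniformOn s

/-- Weak* convergence of a sequence of measures against continuous test functions. -/
def WeakLimit [TopologicalSpace X] [MeasurableSpace X] (μs : ℕ → Measure X) (ν : Measure X) :
    Prop :=
  ∀ φ : C(X, ℝ), Tendsto (fun n => ∫ x, φ x ∂(μs n)) atTop (𝓝 (∫ x, φ x ∂ν))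

/-- `ν` is a weak* accumulation point of the sequence `μs`. -/
def WeakClusterPt [TopologicalSpace X] [MeasurableSpace X] (μs : ℕ → Measure X)
    (ν : Measure X) : Prop :=
  ∃ u : ℕ → ℕ, StrictMono u ∧ WeakLimit (μs ∘ u) ν

/-- `E` is `(n,ε)`-separated for `g`. -/
def IsSep [PseudoMetricSpace X] (g : X → X) (n : ℕ) (ε : ℝ) (E : Set X) : Prop :=
  E.Pairwise fun x y => ∃ j < n, ε < dist (g^[j] x) (g^[j] y)

/-- Maximal cardinality of an `(n,ε)`-separated subset of `K` for `g`. -/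
noncomputable def sepCard [PseudoMetricSpace X] (g : X → X) (K : Set X) (n : ℕ) (ε : ℝ) :
    ℝ≥0∞ :=
  ⨆ (E : Finset X) (_ : ↑E ⊆ K ∧ IsSep g n ε ↑E), (E.card : ℝ≥0∞)

/-- Topological entropy of `g` relative to the set `K`:
`h_top(g,K) = lim_{ε→0} limsup_n (1/n) log E_K(n,ε)`; since the inner quantity is
monotone in `ε`, the limit as `ε → 0` is the supremum over `ε > 0`. -/
noncomputable def relEntropy [PseudoMetricSpace X] (g : X → X) (K : Set X) : EReal :=
  ⨆ (ε : ℝ) (_ : 0 < ε),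
    Filter.limsup (fun n : ℕ => ENNReal.log (sepCard g K n ε) / (n : EReal)) atTop

/-- Topological entropy of `g`. -/
noncomputable def topEntropy [PseudoMetricSpace X] (g : X → X) : EReal :=
  relEntropy g Set.univ

/-- A finite measurable partition of `X`. -/
def IsMPartition [MeasurableSpace X] (P : Finset (Set X)) : Prop :=
  (∀ A ∈ P, MeasurableSet A) ∧ ((P : Set (Set X)).PairwiseDisjoint id) ∧
    ⋃₀ (P : Set (Set X)) = Set.univ

/-- The entropy `H_μ(P ∨ g⁻¹P ∨ ⋯ ∨ g^{-(n-1)}P)` of the `n`-th dynamical refinement of the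
partition `P`. -/
noncomputable def dynH [MeasurableSpace X] (μ : Measure X) (g : X → X) (P : Finset (Set X))
    (n : ℕ) : ℝ :=
  ∑ A : Fin n → ↥P, Real.negMulLog (μ (⋂ i : Fin n, g^[i.1] ⁻¹' ((A i : Set X)))).toReal

/-- The measure-theoretic (Kolmogorov–Sinai) entropy `h_μ(g)`, using that for invariant `μ`
the limit `lim_n H_n/n` equals `inf_n H_n/n` by subadditivity. -/
noncomputable def mEntropy [MeasurableSpace X] (g : X → X) (μ : Measure X) : EReal :=
  ⨆ P : {P : Finset (Set X) // IsMPartition P},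
    ⨅ n : ℕ, ((dynH μ g (P : Finset (Set X)) (n + 1) / (n + 1) : ℝ) : EReal)

section Hyp

variable [MetricSpace X] [CompactSpace X] [MeasurableSpace X] [BorelSpace X]

/-- Hypothesis (H1): every class `[x] = h⁻¹(h x)` has zero relative topological entropy. -/
def HypH1 (g h : X → X) : Prop :=
  ∀ x : X, relEntropy g (h ⁻¹' {h x}) = 0

/-- Hypothesis (H2): every periodic class contains a `g`-periodic point whose `g`-period is
the `f`-period of `h x`. -/
def HypH2 (f g h : X → X) : Prop :=
  ∀ x : X, h x ∈ Function.periodicPts f →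
    ∃ y : X, h y = h x ∧ Function.minimalPeriod g y = Function.minimalPeriod f (h x)

/-- Hypothesis (H3): the set of points whose class is trivial has full Bowen measure. -/
def HypH3 (h : X → X) (μ : Measure X) : Prop :=
  μ {y : X | ∃ x : X, h ⁻¹' {y} = {x}} = 1

/-- `P` is an admissible choice of the sets `P̃er_n(g)`: `P n` consists of `g`-periodic points
of period `n` lying over `Per_n(f)`, and `h` maps `P n` bijectively onto `Per_n(f)`. -/
def IsPerSelection (f g h : X → X) (P : ℕ → Set X) : Prop :=
  ∀ n : ℕ, P n ⊆ perSet g n ∧ (∀ x ∈ P n, g x ∈ P n) ∧ Set.BijOn h (P n) (perSet f n)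

end Hyp

end Samva

open Samva


set_option linter.unusedSectionVars false

namespace SamvaAux

/-! ### Finite entropy calculus -/

/-- Gibbs' inequality, termwise. -/
lemma negMulLog_le_aux {r t : ℝ} (hr : 0 ≤ r) (ht : 0 ≤ t) (h0 : t = 0 → r = 0) :
    Real.negMulLog r ≤ - r * Real.log t + (t - r) := by
  rcases hr.eq_or_lt with rfl | hr
  · simpa using ht
  have htp : 0 < t := by
    rcases ht.eq_or_lt with h | h
    · exact absurd (h0 h.symm) hr.ne'
    · exact h
  have h1 := Real.log_le_sub_one_of_pos (div_pos htp hr)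
  rw [Real.log_div htp.ne' hr.ne'] at h1
  have h2 := mul_le_mul_of_nonneg_left h1 hr.le
  have h3 : r * (t / r - 1) = t - r := by field_simp
  rw [h3] at h2
  rw [Real.negMulLog]
  linarith

/-- Jensen: the entropy of a finite vector supported on at most `exp ℓ` points. -/
lemma sum_negMulLog_le {ι : Type*} (s : Finset ι) (r : ι → ℝ) (hr : ∀ i ∈ s, 0 ≤ r i) (c : ℝ)
    (hc : (s.card : ℝ) ≤ c) :
    ∑ i ∈ s, Real.negMulLog (r i) ≤
      Real.negMulLog (∑ i ∈ s, r i) + (∑ i ∈ s, r i) * Real.log c := by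
  set q := ∑ i ∈ s, r i with hq
  rcases s.eq_empty_or_nonempty with rfl | hs
  · simp [hq]
  have hcard : (0 : ℝ) < s.card := by exact_mod_cast hs.card_pos
  have hcpos : 0 < c := hcard.trans_le hc
  have hq0 : 0 ≤ q := Finset.sum_nonneg hr
  have hle : ∀ i ∈ s, r i ≤ q := fun i hi => Finset.single_le_sum hr hi
  have key : ∀ i ∈ s, Real.negMulLog (r i) ≤ - r i * Real.log (q / c) + (q / c - r i) := by
    intro i hi
    apply negMulLog_le_aux (hr i hi) (by positivity)
    intro h
    have : q = 0 := by
      rcases div_eq_zero_iff.1 h with h | h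
      · exact h
      · exact absurd h hcpos.ne'
    have := hle i hi
    have := hr i hi
    linarith
  have h1 := Finset.sum_le_sum key
  rw [Finset.sum_add_distrib, ← Finset.sum_mul, Finset.sum_sub_distrib, Finset.sum_neg_distrib,
    Finset.sum_const, nsmul_eq_mul, ← hq] at h1
  have h2 : (s.card : ℝ) * (q / c) ≤ q := by
    rw [mul_div_assoc', div_le_iff₀ hcpos, mul_comm]
    exact mul_le_mul_of_nonneg_left hc hq0
  rcases hq0.eq_or_lt with h0 | hqp
  · rw [← h0] at h1 h2 ⊢
    simp at h1 h2 ⊢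
    linarith
  · rw [Real.log_div hqp.ne' hcpos.ne'] at h1
    rw [Real.negMulLog]
    linarith

lemma negMulLog_sum_le {ι : Type*} (s : Finset ι) (r : ι → ℝ) (hr : ∀ i ∈ s, 0 ≤ r i) :
    Real.negMulLog (∑ i ∈ s, r i) ≤ ∑ i ∈ s, Real.negMulLog (r i) := by
  set q := ∑ i ∈ s, r i with hq
  have hle : ∀ i ∈ s, r i ≤ q := fun i hi => Finset.single_le_sum hr hi
  have : Real.negMulLog q = ∑ i ∈ s, - r i * Real.log q := by
    rw [← Finset.sum_mul, Finset.sum_neg_distrib, Real.negMulLog]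
  rw [this]
  apply Finset.sum_le_sum
  intro i hi
  rw [Real.negMulLog]
  rcases (hr i hi).eq_or_lt with h | h
  · simp [← h]
  · have := Real.log_le_log h (hle i hi)
    nlinarith

variable {X : Type*} [MeasurableSpace X]

/-- Finite measurable labellings. -/
def MeasF {ι : Type*} (ξ : X → ι) : Prop := ∀ i, MeasurableSet (ξ ⁻¹' {i})

/-- Entropy of a labelling. -/
noncomputable def HH {ι : Type*} [Fintype ι] (η : Measure X) (ξ : X → ι) : ℝ :=
  ∑ i, Real.negMulLog (η.real (ξ ⁻¹' {i}))

lemma MeasF.pair {ι κ : Type*} {ξ : X → ι} {ζ : X → κ} (hξ : MeasF ξ) (hζ : MeasF ζ) :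
    MeasF (fun x => (ξ x, ζ x)) := by
  rintro ⟨i, k⟩
  have : (fun x => (ξ x, ζ x)) ⁻¹' {(i, k)} = ξ ⁻¹' {i} ∩ ζ ⁻¹' {k} := by
    ext x; simp [Prod.ext_iff]
  rw [this]
  exact (hξ i).inter (hζ k)

lemma MeasF.comp {ι : Type*} {ξ : X → ι} (hξ : MeasF ξ) {T : X → X} (hT : Measurable T) :
    MeasF (fun x => ξ (T x)) := fun i => hT (hξ i)

/-- Words of length `n`. -/
def word {ι : Type*} (T : X → X) (ξ : X → ι) (n : ℕ) (x : X) : Fin n → ι :=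
  fun i => ξ (T^[i.1] x)

lemma word_preimage {ι : Type*} (T : X → X) (ξ : X → ι) (n : ℕ) (w : Fin n → ι) :
    word T ξ n ⁻¹' {w} = ⋂ i : Fin n, T^[i.1] ⁻¹' (ξ ⁻¹' {w i}) := by
  ext x; simp [word, funext_iff]

lemma MeasF.word {ι : Type*} {ξ : X → ι} (hξ : MeasF ξ) {T : X → X} (hT : Measurable T) (n : ℕ) :
    MeasF (word T ξ n) := by
  intro w
  rw [word_preimage]
  exact MeasurableSet.iInter fun i => (hT.iterate i.1) (hξ _)

variable (η : Measure X) [IsProbabilityMeasure η]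

lemma fib {ι : Type*} [Fintype ι] {ξ : X → ι} (hξ : MeasF ξ) (Q : ι → Prop) [DecidablePred Q] :
    η.real {x | Q (ξ x)} = ∑ i with Q i, η.real (ξ ⁻¹' {i}) := by
  rw [sum_measureReal_preimage_singleton _ (fun y _ => hξ y)]
  congr 1
  ext x; simp

lemma fib_one {ι : Type*} [Fintype ι] {ξ : X → ι} (hξ : MeasF ξ) :
    ∑ i, η.real (ξ ⁻¹' {i}) = 1 := by
  have := fib η hξ (fun _ => True)
  simp at this
  exact this.symm

lemma fib_inter {ι : Type*} [Fintype ι] {ξ : X → ι} (hξ : MeasF ξ) {A : Set X} :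
    η.real A = ∑ i, η.real (ξ ⁻¹' {i} ∩ A) := by
  have h1 : ∀ i, η.real (ξ ⁻¹' {i} ∩ A) = (η.restrict A).real (ξ ⁻¹' {i}) := fun i => by
    rw [measureReal_restrict_apply (hξ i)]
  simp_rw [h1]
  rw [sum_measureReal_preimage_singleton _ (fun y _ => hξ y)]
  simp

lemma pair_preimage {ι κ : Type*} (ξ : X → ι) (ζ : X → κ) (i : ι) (k : κ) :
    (fun x => (ξ x, ζ x)) ⁻¹' {(i, k)} = ξ ⁻¹' {i} ∩ ζ ⁻¹' {k} := by
  ext x; simp [Prod.ext_iff]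

/-- Subadditivity. -/
lemma HH_pair_le {ι κ : Type*} [Fintype ι] [Fintype κ] {ξ : X → ι} {ζ : X → κ}
    (hξ : MeasF ξ) (hζ : MeasF ζ) :
    HH η (fun x => (ξ x, ζ x)) ≤ HH η ξ + HH η ζ := by
  set p := fun i => η.real (ξ ⁻¹' {i}) with hp
  set q := fun k => η.real (ζ ⁻¹' {k}) with hq
  set r := fun i k => η.real (ξ ⁻¹' {i} ∩ ζ ⁻¹' {k}) with hr
  have e1 : ∀ k, q k = ∑ i, r i k := fun k => fib_inter η hξ
  have e2 : ∀ i, p i = ∑ k, r i k := fun i => by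
    rw [hp, hr]; simp only
    rw [fib_inter η hζ (A := ξ ⁻¹' {i})]
    simp_rw [inter_comm]
  have s1 : ∑ i, p i = 1 := fib_one η hξ
  have s2 : ∑ k, q k = 1 := fib_one η hζ
  have r0 : ∀ i k, 0 ≤ r i k := fun i k => measureReal_nonneg
  have rp : ∀ i k, r i k ≤ p i := fun i k => by
    rw [e2]; exact Finset.single_le_sum (fun k _ => r0 i k) (Finset.mem_univ k)
  have rq : ∀ i k, r i k ≤ q k := fun i k => by
    rw [e1]; exact Finset.single_le_sum (f := fun i => r i k) (fun i _ => r0 i k) (Finset.mem_univ i)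
  have key : ∀ i k, Real.negMulLog (r i k) ≤
      (- r i k * Real.log (p i) + - r i k * Real.log (q k)) + (p i * q k - r i k) := by
    intro i k
    have hp0 := (r0 i k).trans (rp i k)
    have hq0 := (r0 i k).trans (rq i k)
    have := negMulLog_le_aux (r0 i k) (mul_nonneg hp0 hq0) (by
      intro h
      rcases mul_eq_zero.1 h with h | h
      · have := rp i k; have := r0 i k; linarith
      · have := rq i k; have := r0 i k; linarith)
    rcases (r0 i k).eq_or_lt with h | h
    · rw [← h] at this ⊢
      simpa using this
    · rwa [Real.log_mul (h.trans_le (rp i k)).ne' (h.trans_le (rq i k)).ne', mul_add] at this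
  have hH : HH η (fun x => (ξ x, ζ x)) = ∑ i, ∑ k, Real.negMulLog (r i k) := by
    unfold HH
    rw [Fintype.sum_prod_type]
    simp_rw [pair_preimage]
    rfl
  rw [hH]
  refine (Finset.sum_le_sum fun i _ => Finset.sum_le_sum fun k _ => key i k).trans ?_
  simp_rw [Finset.sum_add_distrib, Finset.sum_sub_distrib]
  have t1 : ∑ i, ∑ k, - r i k * Real.log (p i) = HH η ξ := by
    unfold HH
    refine Finset.sum_congr rfl fun i _ => ?_
    rw [← Finset.sum_mul, Finset.sum_neg_distrib, ← e2, Real.negMulLog]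
  have t2 : ∑ i, ∑ k, - r i k * Real.log (q k) = HH η ζ := by
    unfold HH
    rw [Finset.sum_comm]
    refine Finset.sum_congr rfl fun i _ => ?_
    rw [← Finset.sum_mul, Finset.sum_neg_distrib, ← e1, Real.negMulLog]
  have t3 : ∑ i, ∑ k, p i * q k = 1 := by
    simp_rw [← Finset.mul_sum, s2, mul_one, s1]
  have t4 : ∑ i, ∑ k, r i k = 1 := by
    simp_rw [← e2, s1]
  rw [t1, t2, t3, t4]
  simp

/-- Entropy bound by counting. -/
lemma HH_le_count {ι κ : Type*} [Fintype ι] [Fintype κ] {ξ : X → ι} {ζ : X → κ}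
    (hξ : MeasF ξ) (hζ : MeasF ζ) (N : κ → ℝ)
    (hN : ∀ k, ((Set.ncard {i | ∃ x, ξ x = i ∧ ζ x = k} : ℕ) : ℝ) ≤ N k) :
    HH η ξ ≤ HH η ζ + ∑ k, η.real (ζ ⁻¹' {k}) * Real.log (N k) := by
  classical
  set r := fun i k => η.real (ξ ⁻¹' {i} ∩ ζ ⁻¹' {k}) with hr
  have r0 : ∀ i k, 0 ≤ r i k := fun i k => measureReal_nonneg
  have e1 : ∀ k, η.real (ζ ⁻¹' {k}) = ∑ i, r i k := fun k => fib_inter η hξ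
  have e2 : ∀ i, η.real (ξ ⁻¹' {i}) = ∑ k, r i k := fun i => by
    rw [hr]; simp only
    rw [fib_inter η hζ (A := ξ ⁻¹' {i})]
    simp_rw [inter_comm]
  have h1 : HH η ξ ≤ ∑ i, ∑ k, Real.negMulLog (r i k) := by
    unfold HH
    refine Finset.sum_le_sum fun i _ => ?_
    rw [e2]
    exact negMulLog_sum_le _ _ (fun k _ => r0 i k)
  refine h1.trans ?_
  rw [Finset.sum_comm]
  unfold HH
  rw [← Finset.sum_add_distrib]
  refine Finset.sum_le_sum fun k _ => ?_
  set S : Finset ι := Finset.univ.filter (fun i => ∃ x, ξ x = i ∧ ζ x = k) with hS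
  have hz : ∀ i, i ∉ S → r i k = 0 := by
    intro i hi
    have : ξ ⁻¹' {i} ∩ ζ ⁻¹' {k} = ∅ := by
      ext x
      simp only [mem_inter_iff, mem_preimage, mem_singleton_iff, mem_empty_iff_false, iff_false]
      intro hx
      exact hi (by simp only [hS, Finset.mem_filter, Finset.mem_univ, true_and]; exact ⟨x, hx⟩)
    simp [hr, this]
  have e3 : η.real (ζ ⁻¹' {k}) = ∑ i ∈ S, r i k := by
    rw [e1]
    exact (Finset.sum_subset (Finset.subset_univ S) (fun i _ hi => hz i hi)).symm
  have e4 : ∑ i, Real.negMulLog (r i k) = ∑ i ∈ S, Real.negMulLog (r i k) :=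
    (Finset.sum_subset (Finset.subset_univ S) (fun i _ hi => by simp [hz i hi])).symm
  rw [e4, e3]
  apply sum_negMulLog_le _ _ (fun i _ => r0 i k)
  refine le_trans (le_of_eq ?_) (hN k)
  rw [← Set.ncard_coe_finset]
  congr 2
  ext i; simp [hS]

lemma HH_comp {ι : Type*} [Fintype ι] {ξ : X → ι} (hξ : MeasF ξ) {T : X → X} (hT : MeasurePreserving T η η) :
    HH η (fun x => ξ (T x)) = HH η ξ := by
  unfold HH
  refine Finset.sum_congr rfl fun i _ => ?_
  congr 1
  exact hT.measureReal_preimage (hξ i).nullMeasurableSet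

lemma HH_equiv {ι κ : Type*} [Fintype ι] [Fintype κ] {ξ : X → ι} (e : ι ≃ κ) :
    HH η (fun x => e (ξ x)) = HH η ξ := by
  unfold HH
  rw [← e.sum_comp]
  refine Finset.sum_congr rfl fun i _ => ?_
  congr 2
  ext x; simp

lemma HH_word_le {ι : Type*} [Fintype ι] {ξ : X → ι} (hξ : MeasF ξ) {T : X → X}
    (hT : MeasurePreserving T η η) (n : ℕ) :
    HH η (word T ξ n) ≤ n * HH η ξ := by
  classical
  induction n with
  | zero =>
    have : HH η (word T ξ 0) = 0 := by
      unfold HH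
      have : ∀ i, word T ξ 0 ⁻¹' {i} = univ := fun i => by ext x; simp; exact Subsingleton.elim _ _
      simp [this]
    simp [this]
  | succ n ih =>
    have h1 : HH η (word T ξ (n+1)) = HH η (fun x => (ξ (T^[n] x), word T ξ n x)) := by
      rw [← HH_equiv η (Fin.snocEquiv (fun _ => ι))]
      congr 1
      ext x i
      refine Fin.lastCases ?_ (fun j => ?_) i
      · simp [word, Fin.snocEquiv]
      · simp [word, Fin.snocEquiv]
    rw [h1]
    have h2 := HH_pair_le η (hξ.comp (hT.measurable.iterate n)) (hξ.word hT.measurable n)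
    rw [HH_comp η hξ (hT.iterate n)] at h2
    push_cast
    linarith

end SamvaAux

namespace SamvaAux

/-! ### Separated sets and labellings -/

section Cover

variable {X : Type*} [MetricSpace X]

lemma exists_max_sep (g : X → X) (K : Set X) (n : ℕ) {ε : ℝ} (hε : 0 ≤ ε) (B : ℕ)
    (hB : ∀ E : Finset X, ↑E ⊆ K → IsSep g n ε ↑E → E.card ≤ B) :
    ∃ E : Finset X, ↑E ⊆ K ∧ IsSep g n ε ↑E ∧
      ∀ x ∈ K, ∃ e ∈ E, ∀ j < n, dist (g^[j] x) (g^[j] e) ≤ ε := by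
  classical
  set S : Set ℕ := {k | ∃ E : Finset X, ↑E ⊆ K ∧ IsSep g n ε ↑E ∧ E.card = k} with hS
  have hne : S.Nonempty := ⟨0, ∅, by simp, by simp [IsSep], by simp⟩
  have hbd : BddAbove S := ⟨B, by rintro k ⟨E, h1, h2, rfl⟩; exact hB E h1 h2⟩
  obtain ⟨E, h1, h2, h3⟩ := Nat.sSup_mem hne hbd
  refine ⟨E, h1, h2, fun x hx => ?_⟩
  by_contra! hcon
  have hxE : x ∉ E := fun h => by
    obtain ⟨j, _, hj⟩ := hcon x h
    simp at hj; linarith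
  have : (insert x E).card ∈ S := by
    refine ⟨insert x E, ?_, ?_, rfl⟩
    · rw [Finset.coe_insert]; exact insert_subset hx h1
    · rw [IsSep, Finset.coe_insert, Set.pairwise_insert]
      refine ⟨h2, fun b hb _ => ?_⟩
      obtain ⟨j, hj, hj'⟩ := hcon b hb
      exact ⟨⟨j, hj, hj'⟩, ⟨j, hj, by rwa [dist_comm]⟩⟩
  have := le_csSup hbd this
  rw [Finset.card_insert_of_notMem hxE, h3] at this
  omega

/-- A labelling of `S` by `N` labels such that points with the same label stay close for
time `L`. -/
def Lab (g : X → X) (ε : ℝ) (L : ℕ) (S : Set X) (N : ℕ) : Prop :=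
  ∃ c : X → Fin N, ∀ x ∈ S, ∀ y ∈ S, c x = c y → ∀ j < L, dist (g^[j] x) (g^[j] y) ≤ ε

lemma Lab.mono {g : X → X} {ε : ℝ} {L L' : ℕ} {S S' : Set X} {N : ℕ} (h : Lab g ε L S N)
    (hL : L' ≤ L) (hS : S' ⊆ S) : Lab g ε L' S' N := by
  obtain ⟨c, hc⟩ := h
  exact ⟨c, fun x hx y hy hxy j hj => hc x (hS hx) y (hS hy) hxy j (hj.trans_le hL)⟩

lemma Lab.add {g : X → X} {ε : ℝ} {a b : ℕ} {S : Set X} {N N' : ℕ} (h : Lab g ε a S N)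
    (h' : Lab g ε b (g^[a] '' S) N') : Lab g ε (a + b) S (N * N') := by
  obtain ⟨c, hc⟩ := h
  obtain ⟨c', hc'⟩ := h'
  refine ⟨fun x => finProdFinEquiv (c x, c' (g^[a] x)), fun x hx y hy hxy j hj => ?_⟩
  have := finProdFinEquiv.injective hxy
  simp only [Prod.mk.injEq] at this
  by_cases hja : j < a
  · exact hc x hx y hy this.1 j hja
  · have := hc' _ (mem_image_of_mem _ hx) _ (mem_image_of_mem _ hy) this.2 (j - a) (by omega)
    rwa [← Function.iterate_add_apply, ← Function.iterate_add_apply,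
      Nat.sub_add_cancel (by omega)] at this

variable [CompactSpace X]

lemma lab_univ (g : X → X) {ε : ℝ} (hε : 0 < ε) :
    ∃ c : ℕ, 1 ≤ c ∧ ∀ L, Lab g ε L univ (c ^ L) := by
  classical
  obtain ⟨t, -, htf, hcov⟩ := (isCompact_univ : IsCompact (univ : Set X)).finite_cover_balls
    (half_pos hε)
  have : ∀ x : X, ∃ y : X, y ∈ htf.toFinset ∧ dist x y < ε / 2 := by
    intro x
    have := hcov (mem_univ x)
    simp only [mem_iUnion, Metric.mem_ball] at this
    obtain ⟨y, hy, hxy⟩ := this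
    exact ⟨y, by simpa using hy, hxy⟩
  choose p hp hp' using this
  have h1 : ∃ c : ℕ, 1 ≤ c ∧ Lab g ε 1 univ c := by
    rcases isEmpty_or_nonempty X with hX | hX
    · exact ⟨1, le_rfl, fun _ => 0, fun x => hX.elim x⟩
    · refine ⟨htf.toFinset.card, Finset.card_pos.2 ⟨_, hp (Classical.arbitrary X)⟩,
        fun x => htf.toFinset.equivFin ⟨p x, hp x⟩, fun x _ y _ hxy j hj => ?_⟩
      obtain rfl : j = 0 := by omega
      have := (htf.toFinset.equivFin).injective hxy
      simp only [Subtype.mk.injEq] at this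
      have a1 := hp' x
      have a2 := hp' y
      rw [← this] at a2
      simp only [Function.iterate_zero, id]
      linarith [dist_triangle_right x y (p x)]
  obtain ⟨c, hc, hlab⟩ := h1
  refine ⟨c, hc, fun L => ?_⟩
  induction L with
  | zero => exact ⟨fun _ => ⟨0, by simp⟩, fun x _ y _ _ j hj => by omega⟩
  | succ L ih =>
    rw [pow_succ]
    exact ih.add (hlab.mono le_rfl (subset_univ _))

lemma sep_bound {g : X → X} {K : Set X} (hK : relEntropy g K = 0) {ε δ : ℝ} (hε : 0 < ε)
    (hδ : 0 < δ) : ∃ n : ℕ, 1 ≤ n ∧ ∀ E : Finset X, ↑E ⊆ K → IsSep g n ε ↑E →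
      (E.card : ℝ) ≤ Real.exp (δ * n) := by
  have h1 : Filter.limsup (fun n : ℕ => ENNReal.log (sepCard g K n ε) / (n : EReal)) atTop
      < ((δ : ℝ) : EReal) := by
    refine lt_of_le_of_lt ?_ (by exact_mod_cast hδ : (0 : EReal) < δ)
    rw [← hK]
    exact le_iSup₂ (f := fun (ε : ℝ) (_ : 0 < ε) =>
      Filter.limsup (fun n : ℕ => ENNReal.log (sepCard g K n ε) / (n : EReal)) atTop) ε hε
  obtain ⟨n, hn1, hn2⟩ := ((eventually_lt_of_limsup_lt h1).and (eventually_ge_atTop 1)).exists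
  refine ⟨n, hn2, fun E hE hsep => ?_⟩
  rcases E.eq_empty_or_nonempty with rfl | hne
  · simp; positivity
  have hn0 : (0 : EReal) < (n : EReal) := by exact_mod_cast hn2
  have hnt : (n : EReal) ≠ ⊤ := EReal.natCast_ne_top n
  rw [EReal.div_lt_iff hn0 hnt] at hn1
  have h2 : (E.card : ℝ≥0∞) ≤ sepCard g K n ε :=
    le_iSup₂ (f := fun (E : Finset X) (_ : ↑E ⊆ K ∧ IsSep g n ε ↑E) => (E.card : ℝ≥0∞)) E
      ⟨hE, hsep⟩
  have h3 := (ENNReal.log_le_log h2).trans hn1.le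
  have hc : (0 : ℝ) < E.card := by exact_mod_cast hne.card_pos
  rw [ENNReal.log_pos_real' (by simpa using hc)] at h3
  simp only [ENNReal.toReal_natCast] at h3
  have h4 : Real.log E.card ≤ δ * n := by exact_mod_cast h3
  rwa [Real.log_le_iff_le_exp hc] at h4

/-- Local fibre labelling. -/
lemma lab_fiber {g h : X → X} (hg : Continuous g) (hh : Continuous h) (y : X)
    (hK : relEntropy g (h ⁻¹' {y}) = 0) {ε δ : ℝ} (hε : 0 < ε) (hδ : 0 < δ) :
    ∃ (n : ℕ) (r : ℝ) (N : ℕ), 1 ≤ n ∧ 0 < r ∧ (N : ℝ) ≤ Real.exp (δ * n) ∧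
      Lab g ε n (h ⁻¹' Metric.ball y r) N := by
  classical
  obtain ⟨n, hn, hb⟩ := sep_bound hK (show 0 < ε / 4 by linarith) hδ
  obtain ⟨E, hE, hsep, hspan⟩ := exists_max_sep g (h ⁻¹' {y}) n (show 0 ≤ ε / 4 by linarith)
    ⌊Real.exp (δ * n)⌋₊ (fun E h1 h2 => Nat.le_floor (hb E h1 h2))
  set O : X → Set X := fun e => ⋂ j ∈ Finset.range n, {x | dist (g^[j] x) (g^[j] e) < ε / 2}
    with hO
  have hOo : ∀ e, IsOpen (O e) := fun e => by
    apply isOpen_biInter_finset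
    intro j _
    exact isOpen_lt ((hg.iterate j).dist continuous_const) continuous_const
  set U : Set X := ⋃ e ∈ E, O e with hU
  have hUo : IsOpen U := isOpen_biUnion fun e _ => hOo e
  have hfib : h ⁻¹' {y} ⊆ U := by
    intro x hx
    obtain ⟨e, he, hxe⟩ := hspan x hx
    simp only [hU, mem_iUnion, hO, mem_iInter, Finset.mem_range, mem_ofPred_eq]
    exact ⟨e, he, fun j hj => (hxe j hj).trans_lt (by linarith)⟩
  have hcl : IsClosed (h '' Uᶜ) := (hUo.isClosed_compl.isCompact.image hh).isClosed
  have hy : y ∈ (h '' Uᶜ)ᶜ := by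
    rintro ⟨x, hx, hxy⟩
    exact hx (hfib hxy)
  obtain ⟨r, hr, hball⟩ := Metric.isOpen_iff.1 hcl.isOpen_compl y hy
  have hsub : h ⁻¹' Metric.ball y r ⊆ U := by
    intro x hx
    by_contra hxU
    exact hball hx ⟨x, hxU, rfl⟩
  rcases (h ⁻¹' Metric.ball y r).eq_empty_or_nonempty with he | ⟨x0, hx0⟩
  · refine ⟨n, r, 1, hn, hr, ?_, fun _ => 0, fun x hx => ?_⟩
    · rw [Nat.cast_one]; exact Real.one_le_exp (by positivity)
    · rw [he] at hx; exact hx.elim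
  have hex : ∀ x, ∃ e : E, x ∈ h ⁻¹' Metric.ball y r → x ∈ O e := by
    intro x
    by_cases hx : x ∈ h ⁻¹' Metric.ball y r
    · have := hsub hx
      simp only [hU, mem_iUnion] at this
      obtain ⟨e, he, hxe⟩ := this
      exact ⟨⟨e, he⟩, fun _ => hxe⟩
    · have := hsub hx0
      simp only [hU, mem_iUnion] at this
      obtain ⟨e, he, hxe⟩ := this
      exact ⟨⟨e, he⟩, fun h => absurd h hx⟩
  choose c hc using hex
  refine ⟨n, r, E.card, hn, hr, hb E hE hsep, fun x => E.equivFin (c x),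
    fun x hx x' hx' hxx j hj => ?_⟩
  have heq := E.equivFin.injective hxx
  have a1 := hc x hx
  have a2 := hc x' hx'
  rw [← heq] at a2
  simp only [hO, mem_iInter, Finset.mem_range, mem_ofPred_eq] at a1 a2
  have := a1 j hj
  have := a2 j hj
  linarith [dist_triangle_right (g^[j] x) (g^[j] x') (g^[j] (c x))]

/-- Uniform fibre labelling. -/
lemma lab_fiber_unif {g h : X → X} (hg : Continuous g) (hh : Continuous h)
    (hK : ∀ y, relEntropy g (h ⁻¹' {y}) = 0) {ε δ : ℝ} (hε : 0 < ε) (hδ : 0 < δ) :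
    ∃ (ρ : ℝ) (m : ℕ), 0 < ρ ∧ ∀ y, ∃ n N : ℕ, 1 ≤ n ∧ n ≤ m ∧ (N : ℝ) ≤ Real.exp (δ * n) ∧
      Lab g ε n (h ⁻¹' Metric.ball y ρ) N := by
  classical
  choose n r N hn hr hN hlab using fun y => lab_fiber hg hh y (hK y) hε hδ
  obtain ⟨t, ht⟩ := (isCompact_univ : IsCompact (univ : Set X)).elim_finite_subcover
    (fun y => Metric.ball y (r y)) (fun y => Metric.isOpen_ball)
    (fun y _ => mem_iUnion.2 ⟨y, Metric.mem_ball_self (hr y)⟩)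
  obtain ⟨ρ, hρ, hleb⟩ := lebesgue_number_lemma_of_metric
    (isCompact_univ : IsCompact (univ : Set X)) (c := fun i : t => Metric.ball i.1 (r i.1))
    (fun i => Metric.isOpen_ball) (by simpa [iUnion_subtype] using ht)
  refine ⟨ρ, t.sup n, hρ, fun y => ?_⟩
  obtain ⟨⟨i, hi⟩, hsub⟩ := hleb y (mem_univ y)
  exact ⟨n i, N i, hn i, Finset.le_sup hi, hN i, (hlab i).mono le_rfl (preimage_mono hsub)⟩

lemma semiconj_iter {f g h : X → X} (hsemi : ∀ x, f (h x) = h (g x)) (j : ℕ) (x : X) :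
    f^[j] (h x) = h (g^[j] x) := by
  have : Function.Semiconj h g f := fun x => (hsemi x).symm
  exact ((this.iterate_right j) x).symm

lemma lab_orbit {f g h : X → X} (hg : Continuous g) (hh : Continuous h)
    (hsemi : ∀ x, f (h x) = h (g x))
    (hK : ∀ y, relEntropy g (h ⁻¹' {y}) = 0) {ε δ : ℝ} (hε : 0 < ε) (hδ : 0 < δ) :
    ∃ (ρ : ℝ) (m : ℕ), 0 < ρ ∧ ∀ (L : ℕ) (S : Set X),
      (∀ x ∈ S, ∀ y ∈ S, ∀ j < L, dist (f^[j] (h x)) (f^[j] (h y)) < ρ) →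
      ∃ N : ℕ, (N : ℝ) ≤ Real.exp (δ * m) * Real.exp (δ * L) ∧ Lab g ε L S N := by
  obtain ⟨ρ, m, hρ, H⟩ := lab_fiber_unif hg hh hK hε hδ
  refine ⟨ρ, m, hρ, fun L => ?_⟩
  induction L using Nat.strong_induction_on with
  | _ L ih =>
    intro S hS
    rcases S.eq_empty_or_nonempty with rfl | ⟨x0, hx0⟩
    · refine ⟨1, ?_, fun _ => 0, fun x hx => hx.elim⟩
      rw [Nat.cast_one]
      exact one_le_mul_of_one_le_of_one_le (Real.one_le_exp (by positivity))
        (Real.one_le_exp (by positivity))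
    rcases Nat.eq_zero_or_pos L with rfl | hL
    · refine ⟨1, ?_, fun _ => 0, fun x hx y hy _ j hj => by omega⟩
      rw [Nat.cast_one]
      exact one_le_mul_of_one_le_of_one_le (Real.one_le_exp (by positivity))
        (Real.one_le_exp (by positivity))
    obtain ⟨n, N, hn1, hnm, hN, hlab⟩ := H (h x0)
    have hsub : S ⊆ h ⁻¹' Metric.ball (h x0) ρ := fun x hx => by
      simpa using hS x hx x0 hx0 0 hL
    have hlab' := hlab.mono le_rfl hsub
    by_cases hLn : L ≤ n
    · refine ⟨N, hN.trans ?_, hlab'.mono hLn subset_rfl⟩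
      have h1 : Real.exp (δ * n) ≤ Real.exp (δ * m) := by
        apply Real.exp_le_exp.2
        have : (n : ℝ) ≤ m := by exact_mod_cast hnm
        nlinarith
      have h2 : 1 ≤ Real.exp (δ * L) := Real.one_le_exp (by positivity)
      nlinarith [Real.exp_pos (δ * m)]
    · push Not at hLn
      obtain ⟨N', hN', hl'⟩ := ih (L - n) (by omega) (g^[n] '' S) (by
        rintro _ ⟨x, hx, rfl⟩ _ ⟨y, hy, rfl⟩ j hj
        rw [← semiconj_iter hsemi, ← semiconj_iter hsemi, ← Function.iterate_add_apply,
          ← Function.iterate_add_apply]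
        exact hS x hx y hy _ (by omega))
      refine ⟨N * N', ?_, (hlab'.add hl').mono (by omega) subset_rfl⟩
      rw [Nat.cast_mul]
      calc (N : ℝ) * N' ≤ Real.exp (δ * n) * (Real.exp (δ * m) * Real.exp (δ * (L - n : ℕ))) := by
            gcongr
        _ = Real.exp (δ * m) * Real.exp (δ * L) := by
            rw [← Real.exp_add, ← Real.exp_add, ← Real.exp_add, Nat.cast_sub hLn.le]
            congr 1; ring

/-- Fibre labelling along `α`-close orbits of an expansive map. -/
lemma lab_expansive {f g h : X → X} (hg : Continuous g) (hh : Continuous h)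
    (hsemi : ∀ x, f (h x) = h (g x))
    (hK : ∀ y, relEntropy g (h ⁻¹' {y}) = 0) {α : ℝ}
    (hexp : ∀ ρ > 0, ∃ k : ℕ, ∀ a b : X, (∀ j < 2 * k + 1, dist (f^[j] a) (f^[j] b) ≤ α) →
      dist (f^[k] a) (f^[k] b) < ρ) {ε δ : ℝ} (hε : 0 < ε) (hδ : 0 < δ) :
    ∃ C : ℝ, 0 < C ∧ ∀ (L : ℕ) (S : Set X),
      (∀ x ∈ S, ∀ y ∈ S, ∀ j < L, dist (f^[j] (h x)) (f^[j] (h y)) ≤ α) →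
      ∃ N : ℕ, (N : ℝ) ≤ C * Real.exp (δ * L) ∧ Lab g ε L S N := by
  obtain ⟨ρ, m, hρ, H⟩ := lab_orbit hg hh hsemi hK hε hδ
  obtain ⟨k, hk⟩ := hexp ρ hρ
  obtain ⟨c, hc1, hc⟩ := lab_univ g hε
  have hc0 : (0 : ℝ) < c := by exact_mod_cast hc1
  refine ⟨(c : ℝ) ^ k * (c : ℝ) ^ k * Real.exp (δ * m), by positivity, fun L S hS => ?_⟩
  obtain ⟨N, hN, hl⟩ := H (L - 2 * k) (g^[k] '' S) (by
    rintro _ ⟨x, hx, rfl⟩ _ ⟨y, hy, rfl⟩ j hj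
    rw [← semiconj_iter hsemi, ← semiconj_iter hsemi, ← Function.iterate_add_apply,
      ← Function.iterate_add_apply, add_comm j k, Function.iterate_add_apply,
      Function.iterate_add_apply]
    apply hk
    intro i hi
    rw [← Function.iterate_add_apply, ← Function.iterate_add_apply]
    exact hS x hx y hy _ (by omega))
  have h1 := (((hc k).mono le_rfl (subset_univ S)).add hl).add
    ((hc k).mono le_rfl (subset_univ _))
  refine ⟨c ^ k * N * c ^ k, ?_, h1.mono (by omega) subset_rfl⟩
  push_cast
  have h2 : Real.exp (δ * (L - 2 * k : ℕ)) ≤ Real.exp (δ * L) := by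
    apply Real.exp_le_exp.2
    have : ((L - 2 * k : ℕ) : ℝ) ≤ L := by exact_mod_cast Nat.sub_le _ _
    nlinarith
  calc (c : ℝ) ^ k * N * c ^ k
      ≤ (c : ℝ) ^ k * (Real.exp (δ * m) * Real.exp (δ * L)) * c ^ k := by
        gcongr
        exact hN.trans (by gcongr)
    _ = _ := by ring

end Cover
end SamvaAux

namespace SamvaAux

section Ent

variable {X : Type*} [MetricSpace X] [CompactSpace X] [MeasurableSpace X] [BorelSpace X]

lemma exists_theta (R τ : ℝ) (hτ : 0 < τ) : ∃ θ > 0, ∀ t : ℝ, 0 ≤ t → t ≤ θ →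
    Real.negMulLog t + Real.negMulLog (1 - t) + t * Real.log R ≤ τ := by
  have hc : Continuous fun t : ℝ =>
      Real.negMulLog t + Real.negMulLog (1 - t) + t * Real.log R := by
    have := Real.continuous_negMulLog
    fun_prop
  have h0 := (hc.tendsto 0).eventually_lt_const (u := τ) (by simpa using hτ)
  obtain ⟨θ, hθ, H⟩ := Metric.eventually_nhds_iff.1 h0
  refine ⟨θ / 2, by positivity, fun t ht1 ht2 => (H ?_).le⟩
  rw [Real.dist_eq, sub_zero, abs_of_nonneg ht1]
  linarith

/-- Compact approximation of a finite partition. -/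
lemma exists_compacts (η : Measure X) [IsProbabilityMeasure η] {κ : Type*} [Fintype κ]
    {ξ : X → κ} (hξ : MeasF ξ) {θ : ℝ} (hθ : 0 < θ) :
    ∃ B : Set X, MeasurableSet B ∧ η.real B ≤ θ ∧ ∃ ε > 0, ∀ x ∉ B, ∀ y ∉ B,
      dist x y ≤ ε → ξ x = ξ y := by
  classical
  set R : ℝ := (Fintype.card κ : ℝ)
  have hR : 0 ≤ R := by positivity
  have hpos : ENNReal.ofReal (θ / (R + 1)) ≠ 0 := by
    simp; positivity
  choose K hKs hKc hKm using fun i => (hξ i).exists_isCompact_sdiff_lt (μ := η)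
    (measure_ne_top _ _) hpos
  refine ⟨(⋃ i, K i)ᶜ, (MeasurableSet.iUnion fun i => (hKc i).measurableSet).compl, ?_, ?_⟩
  · have hsub : (⋃ i, K i)ᶜ ⊆ ⋃ i, (ξ ⁻¹' {i} \ K i) := by
      intro x hx
      simp only [mem_compl_iff, mem_iUnion, not_exists] at hx
      exact mem_iUnion.2 ⟨ξ x, rfl, hx _⟩
    have h1 : η.real (⋃ i, K i)ᶜ ≤ ∑ i, η.real (ξ ⁻¹' {i} \ K i) :=
      (measureReal_mono hsub).trans (measureReal_iUnion_fintype_le _)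
    refine h1.trans ?_
    have h2 : ∀ i, η.real (ξ ⁻¹' {i} \ K i) ≤ θ / (R + 1) := fun i =>
      ENNReal.toReal_le_of_le_ofReal (by positivity) (hKm i).le
    refine (Finset.sum_le_sum fun i _ => h2 i).trans ?_
    rw [Finset.sum_const, nsmul_eq_mul, Finset.card_univ, mul_div_assoc', div_le_iff₀ (by positivity)]
    change R * θ ≤ _
    nlinarith
  · have hd : ∀ i j, i ≠ j → Disjoint (K i) (K j) := fun i j hij => by
      rw [Set.disjoint_left]
      intro x hx hx'
      exact hij ((hKs i hx).symm.trans (hKs j hx'))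
    have hev : ∀ᶠ ε : ℝ in 𝓝[>] 0, ∀ i j, i ≠ j → ∀ x ∈ K i, ∀ y ∈ K j, ε < dist x y := by
      rw [eventually_all]; intro i
      rw [eventually_all]; intro j
      by_cases hij : i = j
      · exact Eventually.of_forall fun ε h => absurd hij h
      obtain ⟨r, hr, H⟩ := Metric.exists_pos_forall_lt_edist (hKc i) (hKc j).isClosed (hd i j hij)
      have : Ioo (0 : ℝ) r ∈ 𝓝[>] (0 : ℝ) := Ioo_mem_nhdsGT (by exact_mod_cast hr)
      filter_upwards [this] with ε hε _ x hx y hy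
      have := H x hx y hy
      rw [edist_dist, ← ENNReal.ofReal_coe_nnreal] at this
      have := (ENNReal.ofReal_lt_ofReal_iff_of_nonneg (NNReal.coe_nonneg r)).1 this
      exact hε.2.trans this
    obtain ⟨ε, hε, hε0⟩ := (hev.and self_mem_nhdsWithin).exists
    refine ⟨ε, hε0, fun x hx y hy hxy => ?_⟩
    simp only [mem_compl_iff, not_not, mem_iUnion] at hx hy
    obtain ⟨i, hi⟩ := hx
    obtain ⟨j, hj⟩ := hy
    by_contra hne
    have h1 : ξ x = i := hKs i hi
    have h2 : ξ y = j := hKs j hj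
    have := hε i j (by rwa [h1, h2] at hne) x hi y hj
    linarith

/-- Counting words. -/
lemma word_count [Nonempty X] {κ : Type*} [Fintype κ] {g : X → X} {ξ : X → κ} {B : Set X} {ε : ℝ}
    (hB : ∀ x ∉ B, ∀ y ∉ B, dist x y ≤ ε → ξ x = ξ y) (b : X → Bool)
    (hb : ∀ x, b x = true ↔ x ∈ B) {L N : ℕ} {S : Set X} (hl : Lab g ε L S N) (v : Fin L → Bool) :
    Set.ncard {p | ∃ x, word g ξ L x = p ∧ x ∈ S ∧ word g b L x = v} ≤
      N * Fintype.card κ ^ (Fintype.card {j // v j = true}) := by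
  classical
  obtain ⟨c, hc⟩ := hl
  set W := {p | ∃ x, word g ξ L x = p ∧ x ∈ S ∧ word g b L x = v} with hW
  have hex : ∀ p ∈ W, ∃ x, word g ξ L x = p ∧ x ∈ S ∧ word g b L x = v := fun p hp => hp
  choose! rep h1 h2 h3 using hex
  have := Set.ncard_le_ncard_of_injOn (s := W)
    (t := (univ : Set (Fin N × ({j // v j = true} → κ))))
    (fun p => (c (rep p), fun j => p j.1)) (fun p _ => mem_univ _) (by
      intro p hp p' hp' heq
      simp only [Prod.mk.injEq] at heq
      obtain ⟨e1, e2⟩ := heq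
      have hclose := hc _ (h2 p hp) _ (h2 p' hp') e1
      funext j
      by_cases hj : v j = true
      · exact congrFun e2 ⟨j, hj⟩
      · have b1 : b (g^[j.1] (rep p)) = v j := congrFun (h3 p hp) j
        have b2 : b (g^[j.1] (rep p')) = v j := congrFun (h3 p' hp') j
        have c1 : g^[j.1] (rep p) ∉ B := by rw [← hb, b1]; exact hj
        have c2 : g^[j.1] (rep p') ∉ B := by rw [← hb, b2]; exact hj
        have := hB _ c1 _ c2 (hclose j.1 j.2)
        have d1 : ξ (g^[j.1] (rep p)) = p j := congrFun (h1 p hp) j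
        have d2 : ξ (g^[j.1] (rep p')) = p' j := congrFun (h1 p' hp') j
        rw [← d1, ← d2, this]) finite_univ
  refine this.trans (le_of_eq ?_)
  rw [Set.ncard_univ]
  simp

lemma HH_bool (η : Measure X) [IsProbabilityMeasure η] {b : X → Bool} {B : Set X}
    (hBm : MeasurableSet B) (hb : ∀ x, b x = true ↔ x ∈ B) :
    HH η b = Real.negMulLog (η.real B) + Real.negMulLog (1 - η.real B) := by
  have h1 : b ⁻¹' {true} = B := by ext x; simp [hb]
  have h2 : b ⁻¹' {false} = Bᶜ := by ext x; simp [← hb]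
  unfold HH
  rw [Fintype.sum_bool, h1, h2, probReal_compl_eq_one_sub hBm]

/-- The key estimate: entropy upstairs is bounded by entropy of a fine partition downstairs. -/
lemma word_entropy_le (η : Measure X) [IsProbabilityMeasure η] {f g h : X → X}
    (hgm : MeasurePreserving g η η) (hh : Measurable h) (hsemi : ∀ x, f (h x) = h (g x)) {α : ℝ}
    (hlab : ∀ ε > 0, ∀ δ > 0, ∃ C : ℝ, 0 < C ∧ ∀ (L : ℕ) (S : Set X),
      (∀ x ∈ S, ∀ y ∈ S, ∀ j < L, dist (f^[j] (h x)) (f^[j] (h y)) ≤ α) →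
      ∃ N : ℕ, (N : ℝ) ≤ C * Real.exp (δ * L) ∧ Lab g ε L S N)
    {ι : Type*} [Fintype ι] {d : X → ι} (hd : MeasF d) {n : ℕ} (hn : 1 ≤ n)
    (hdα : ∀ y y', d y = d y' → ∀ j < n, dist (f^[j] y) (f^[j] y') ≤ α)
    {κ : Type*} [Fintype κ] {ξ : X → κ} (hξ : MeasF ξ) {τ : ℝ} (hτ : 0 < τ) :
    ∃ L : ℕ, 1 ≤ L ∧
      HH η (word g ξ L) ≤ L * (HH η (fun x => d (h x)) / n + τ) := by
  classical
  have hne : Nonempty X := η.nonempty_of_neZero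
  have hκ : Nonempty κ := hne.map ξ
  set R : ℝ := (Fintype.card κ : ℝ) with hR
  have hR1 : 0 < R := by rw [hR]; exact_mod_cast Fintype.card_pos
  obtain ⟨θ, hθ, hF⟩ := exists_theta R (τ / 3) (by linarith)
  obtain ⟨B, hBm, hBθ, ε, hε, hB⟩ := exists_compacts η hξ hθ
  set b : X → Bool := fun x => decide (x ∈ B) with hbdef
  have hb : ∀ x, b x = true ↔ x ∈ B := fun x => by simp [hbdef]
  have hbm : MeasF b := by
    intro i
    cases i
    · have : b ⁻¹' {false} = Bᶜ := by ext x; simp [hbdef]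
      rw [this]; exact hBm.compl
    · have : b ⁻¹' {true} = B := by ext x; simp [hbdef]
      rw [this]; exact hBm
  obtain ⟨C, hC, hCl⟩ := hlab ε hε (τ / 3) (by linarith)
  obtain ⟨k, hk⟩ := exists_nat_gt (Real.log C / (τ / 3))
  set k' := k + 1 with hk'
  set L := n * k' with hL
  have hL1 : 1 ≤ L := Nat.one_le_iff_ne_zero.2 (by simp [hL, hk']; omega)
  have hkL : (k : ℝ) ≤ L := by
    have : k ≤ L := by rw [hL, hk']; nlinarith
    exact_mod_cast this
  have hlogC : Real.log C ≤ L * (τ / 3) := by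
    rw [div_lt_iff₀ (by linarith)] at hk
    nlinarith
  have hdh : MeasF (fun x => d (h x)) := fun i => hh (hd i)
  set D := word (g^[n]) (fun x => d (h x)) k' with hD
  have hDm : MeasF D := hdh.word (hgm.measurable.iterate n) k'
  have hbw : MeasF (word g b L) := hbm.word hgm.measurable L
  set ζ : X → (Fin k' → ι) × (Fin L → Bool) := fun x => (D x, word g b L x) with hζ
  have hζm : MeasF ζ := hDm.pair hbw
  set cnt : (Fin L → Bool) → ℕ := fun v => Fintype.card {j // v j = true} with hcnt
  set ℓ : (Fin k' → ι) × (Fin L → Bool) → ℝ :=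
    fun z => Real.log C + τ / 3 * L + cnt z.2 * Real.log R with hℓ
  have hcount : ∀ z, ((Set.ncard {i | ∃ x, word g ξ L x = i ∧ ζ x = z} : ℕ) : ℝ) ≤
      Real.exp (ℓ z) := by
    rintro ⟨w, v⟩
    obtain ⟨N, hN, hl⟩ := hCl L {x | D x = w} (by
      intro x hx y hy j hj
      have hdiv : j / n < k' := Nat.div_lt_of_lt_mul hj
      have e1 : d (h (((g^[n])^[j / n]) x)) = w ⟨j / n, hdiv⟩ := congrFun hx ⟨j / n, hdiv⟩
      have e2 : d (h (((g^[n])^[j / n]) y)) = w ⟨j / n, hdiv⟩ := congrFun hy ⟨j / n, hdiv⟩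
      have := hdα _ _ (e1.trans e2.symm) (j % n) (Nat.mod_lt _ hn)
      rw [← Function.iterate_mul, ← semiconj_iter hsemi, ← semiconj_iter hsemi,
        ← Function.iterate_add_apply, ← Function.iterate_add_apply, Nat.mod_add_div] at this
      exact this)
    have h1 := word_count hB b hb hl v
    have h2 : {i | ∃ x, word g ξ L x = i ∧ ζ x = (w, v)} =
        {p | ∃ x, word g ξ L x = p ∧ x ∈ {x | D x = w} ∧ word g b L x = v} := by
      ext p; simp [hζ, Prod.ext_iff]
    rw [h2]
    have h3 : (Set.ncard {p | ∃ x, word g ξ L x = p ∧ x ∈ {x | D x = w} ∧ word g b L x = v} : ℝ)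
        ≤ N * R ^ (cnt v) := by
      refine (Nat.cast_le (α := ℝ).mpr h1).trans (le_of_eq ?_)
      simp [hR, hcnt]
    refine h3.trans ?_
    have h4 : Real.exp (ℓ (w, v)) = C * Real.exp (τ / 3 * L) * R ^ (cnt v) := by
      simp only [hℓ]
      rw [Real.exp_add, Real.exp_add, Real.exp_log hC, Real.exp_nat_mul, Real.exp_log hR1]
    rw [h4]
    gcongr
  have hmain := HH_le_count η (hξ.word hgm.measurable L) hζm (fun z => Real.exp (ℓ z)) hcount
  simp only [Real.log_exp] at hmain
  have hH1 : HH η ζ ≤ HH η D + HH η (word g b L) := HH_pair_le η hDm hbw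
  have hH2 : HH η D ≤ k' * HH η (fun x => d (h x)) := HH_word_le η hdh (hgm.iterate n) k'
  have hH3 : HH η (word g b L) ≤ L * HH η b := HH_word_le η hbm hgm L
  rw [HH_bool η hBm hb] at hH3
  set t := η.real B with ht
  have hsum1 : ∑ z, η.real (ζ ⁻¹' {z}) = 1 := fib_one η hζm
  have hsum2 : ∑ z, η.real (ζ ⁻¹' {z}) * (cnt z.2 : ℝ) = L * t := by
    have e1 : ∀ z : (Fin k' → ι) × (Fin L → Bool), η.real (ζ ⁻¹' {z}) * (cnt z.2 : ℝ) =
        ∑ j : Fin L, if z.2 j = true then η.real (ζ ⁻¹' {z}) else 0 := by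
      intro z
      rw [← Finset.sum_filter, Finset.sum_const, nsmul_eq_mul, mul_comm, hcnt]
      simp only [Fintype.card_subtype]
    simp_rw [e1]
    rw [Finset.sum_comm]
    have e2 : ∀ j : Fin L, (∑ z, if z.2 j = true then η.real (ζ ⁻¹' {z}) else 0) = t := by
      intro j
      rw [← Finset.sum_filter, ← fib η hζm (fun z => z.2 j = true)]
      have : {x | (ζ x).2 j = true} = (g^[j.1]) ⁻¹' B := by
        ext x
        simp [hζ, word, hbdef]
      rw [this]
      exact (hgm.iterate j.1).measureReal_preimage hBm.nullMeasurableSet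
    simp_rw [e2]
    simp
  have hsum : ∑ z, η.real (ζ ⁻¹' {z}) * ℓ z = Real.log C + τ / 3 * L + L * t * Real.log R := by
    simp only [hℓ, mul_add, Finset.sum_add_distrib, ← Finset.sum_mul, ← mul_assoc]
    rw [hsum1, hsum2]
    ring
  rw [hsum] at hmain
  refine ⟨L, hL1, ?_⟩
  have hFt := hF t measureReal_nonneg hBθ
  have hL0 : (0 : ℝ) < L := by exact_mod_cast hL1
  have h5 := mul_le_mul_of_nonneg_left hFt hL0.le
  have hn0 : (0 : ℝ) < n := by exact_mod_cast hn
  have h6 : (L : ℝ) * (HH η (fun x => d (h x)) / n) = k' * HH η (fun x => d (h x)) := by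
    rw [hL]; push_cast; field_simp
  rw [mul_add, h6]
  linarith

lemma mEntropy_le (η : Measure X) [IsProbabilityMeasure η] {f g h : X → X}
    (hgm : MeasurePreserving g η η) (hh : Measurable h) (hsemi : ∀ x, f (h x) = h (g x)) {α : ℝ}
    (hlab : ∀ ε > 0, ∀ δ > 0, ∃ C : ℝ, 0 < C ∧ ∀ (L : ℕ) (S : Set X),
      (∀ x ∈ S, ∀ y ∈ S, ∀ j < L, dist (f^[j] (h x)) (f^[j] (h y)) ≤ α) →
      ∃ N : ℕ, (N : ℝ) ≤ C * Real.exp (δ * L) ∧ Lab g ε L S N)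
    {ι : Type*} [Fintype ι] {d : X → ι} (hd : MeasF d) {n : ℕ} (hn : 1 ≤ n)
    (hdα : ∀ y y', d y = d y' → ∀ j < n, dist (f^[j] y) (f^[j] y') ≤ α) :
    mEntropy g η ≤ ((HH (η.map h) d / n : ℝ) : EReal) := by
  have hmap : HH (η.map h) d = HH η (fun x => d (h x)) := by
    unfold HH
    refine Finset.sum_congr rfl fun i _ => ?_
    rw [map_measureReal_apply hh (hd i)]
    rfl
  rw [hmap]
  refine iSup_le fun P => ?_
  obtain ⟨P, hP1, hP2, hP3⟩ := P
  rw [← EReal.le_of_forall_lt_iff_le]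
  intro z hz
  have hz' : HH η (fun x => d (h x)) / n < z := by exact_mod_cast hz
  have hex : ∀ x : X, ∃ A : P, x ∈ A.1 := fun x => by
    have : x ∈ ⋃₀ (P : Set (Set X)) := by rw [hP3]; trivial
    obtain ⟨A, hA, hx⟩ := this
    exact ⟨⟨A, hA⟩, hx⟩
  choose ξ hξ using hex
  have hpre : ∀ A : P, ξ ⁻¹' {A} = A.1 := by
    intro A
    ext x
    simp only [mem_preimage, mem_singleton_iff]
    constructor
    · rintro rfl; exact hξ x
    · intro hx
      by_contra hne
      have := hP2 (ξ x).2 A.2 (fun h => hne (Subtype.ext h))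
      exact Set.disjoint_left.1 this (hξ x) hx
  have hξm : MeasF ξ := fun A => by rw [hpre]; exact hP1 _ A.2
  obtain ⟨L, hL, hle⟩ := word_entropy_le η hgm hh hsemi hlab hd hn hdα hξm (sub_pos.2 hz')
  refine (iInf_le _ (L - 1)).trans ?_
  have hdyn : dynH η g P L = HH η (word g ξ L) := by
    unfold dynH HH
    refine Finset.sum_congr rfl fun A _ => ?_
    rw [word_preimage]
    simp_rw [hpre]
    rfl
  have hL0 : (0 : ℝ) < L := by exact_mod_cast hL
  have hLe : L - 1 + 1 = L := Nat.sub_add_cancel hL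
  have hLe' : ((L - 1 : ℕ) : ℝ) + 1 = L := by exact_mod_cast hLe
  simp only [hLe, hLe', hdyn]
  rw [EReal.coe_le_coe_iff, div_le_iff₀ hL0]
  refine hle.trans (le_of_eq ?_)
  ring

end Ent
end SamvaAux

namespace SamvaAux

variable {X : Type*} [MetricSpace X] [CompactSpace X]

lemma zIter_eq (f : X ≃ₜ X) (j : ℤ) (x : X) :
    zIter f j x = ((f.toEquiv : Equiv.Perm X) ^ j) x := by
  cases j with
  | ofNat n =>
    simp only [zIter, Int.ofNat_eq_natCast, zpow_natCast]
    rw [← Equiv.Perm.iterate_eq_pow]; rfl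
  | negSucc n =>
    simp only [zIter, zpow_negSucc]
    rw [← inv_pow, ← Equiv.Perm.iterate_eq_pow]; rfl

lemma zIter_nat (f : X ≃ₜ X) (n : ℕ) (x : X) : zIter f (n : ℤ) x = (f : X → X)^[n] x := rfl

lemma zIter_add (f : X ≃ₜ X) (i j : ℤ) (x : X) :
    zIter f (i + j) x = zIter f i (zIter f j x) := by
  simp only [zIter_eq, zpow_add, Equiv.Perm.mul_apply]

lemma zIter_continuous (f : X ≃ₜ X) (j : ℤ) : Continuous (zIter f j) := by
  cases j with
  | ofNat n => exact f.continuous.iterate n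
  | negSucc n => exact f.symm.continuous.iterate (n + 1)

/-- The dynamical facts about `f` that are used below. -/
structure Dyn (f : X → X) (α : ℝ) (M : ℕ) : Prop where
  cont : Continuous f
  hα : 0 < α
  hM : 1 ≤ M
  F1 : ∀ n, 1 ≤ n → ∀ x ∈ perSet f n, ∀ y ∈ perSet f n,
    (∀ j < n, dist (f^[j] x) (f^[j] y) ≤ α) → x = y
  F2 : ∀ ρ > 0, ∃ k : ℕ, ∀ a b : X, (∀ j < 2 * k + 1, dist (f^[j] a) (f^[j] b) ≤ α) →
      dist (f^[k] a) (f^[k] b) < ρ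
  F3 : ∀ (x y w : X) (a b c p : ℕ), a + b + c + 3 * M ≤ p → ∃ z ∈ perSet f p,
    (∀ j < a, dist (f^[j] z) (f^[j] x) ≤ α / 4) ∧
    (∀ j < b, dist (f^[a + M + j] z) (f^[j] y) ≤ α / 4) ∧
    (∀ j < c, dist (f^[a + b + 2 * M + j] z) (f^[j] w) ≤ α / 4)

lemma exp_F1 {f : X ≃ₜ X} {α : ℝ} (hf : IsExpansiveWith f α) (n : ℕ) (hn : 1 ≤ n) (x : X)
    (hx : x ∈ perSet f n) (y : X) (hy : y ∈ perSet f n)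
    (H : ∀ j < n, dist ((f : X → X)^[j] x) ((f : X → X)^[j] y) ≤ α) : x = y := by
  have key : ∀ u : X, u ∈ perSet f n → ∀ m : ℤ, zIter f m u = (f : X → X)^[(m % n).toNat] u := by
    intro u hu m
    have h0 : (0 : ℤ) ≤ m % n := Int.emod_nonneg _ (by omega)
    rw [← zIter_nat, Int.toNat_of_nonneg h0]
    conv_lhs => rw [← Int.emod_add_mul_ediv m n, zIter_add]
    congr 1
    rw [zIter_eq, zpow_mul]
    apply Equiv.Perm.zpow_apply_eq_self_of_apply_eq_self
    rw [← zIter_eq]; exact hu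
  refine hf.2 x y fun m => ?_
  rw [key x hx, key y hy]
  apply H
  have h1 : m % n < n := Int.emod_lt_of_pos _ (by omega)
  have h0 : (0 : ℤ) ≤ m % n := Int.emod_nonneg _ (by omega)
  omega

lemma exp_F2 {f : X ≃ₜ X} {α : ℝ} (hf : IsExpansiveWith f α) (ρ : ℝ) (hρ : 0 < ρ) :
    ∃ k : ℕ, ∀ a b : X, (∀ j < 2 * k + 1, dist ((f : X → X)^[j] a) ((f : X → X)^[j] b) ≤ α) →
      dist ((f : X → X)^[k] a) ((f : X → X)^[k] b) < ρ := by
  by_contra hcon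
  push Not at hcon
  set K : ℕ → Set (X × X) := fun k => {p | ρ ≤ dist p.1 p.2 ∧
    ∀ j : ℤ, |j| ≤ k → dist (zIter f j p.1) (zIter f j p.2) ≤ α} with hK
  have hclosed : ∀ k, IsClosed (K k) := by
    intro k
    have e : K k = {p : X × X | ρ ≤ dist p.1 p.2} ∩ ⋂ (j : ℤ) (_ : |j| ≤ k),
        {p : X × X | dist (zIter f j p.1) (zIter f j p.2) ≤ α} := by
      ext p; simp [hK]
    rw [e]
    refine (isClosed_le continuous_const (continuous_fst.dist continuous_snd)).inter ?_
    refine isClosed_iInter fun j => isClosed_iInter fun _ => ?_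
    exact isClosed_le (((zIter_continuous f j).comp continuous_fst).dist
      ((zIter_continuous f j).comp continuous_snd)) continuous_const
  have hne : ∀ k, (K k).Nonempty := by
    intro k
    obtain ⟨a, b, h1, h2⟩ := hcon k
    refine ⟨((f : X → X)^[k] a, (f : X → X)^[k] b), h2, fun j hj => ?_⟩
    rw [abs_le] at hj
    simp only
    rw [← zIter_nat, ← zIter_nat, ← zIter_add, ← zIter_add]
    have := h1 (j + k).toNat (by omega)
    rw [← zIter_nat, ← zIter_nat, Int.toNat_of_nonneg (by omega)] at this
    exact this
  obtain ⟨⟨a, b⟩, hab⟩ := IsCompact.nonempty_iInter_of_sequence_nonempty_isCompact_isClosed K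
    (fun k p hp => ⟨hp.1, fun j hj => hp.2 j (by push_cast; omega)⟩) hne
    (hclosed 0).isCompact hclosed
  rw [mem_iInter] at hab
  have : a = b := hf.2 a b fun m => (hab m.natAbs).2 m (by simp)
  have h2 := (hab 0).1
  simp only [this, dist_self] at h2
  linarith

lemma exists_dyn {f : X ≃ₜ X} (hexp : IsExpansive f) (hspec : HasSpecification f) :
    ∃ α M, Dyn (f : X → X) α M := by
  obtain ⟨α, hf⟩ := hexp
  obtain ⟨M, hM⟩ := hspec (α / 4) (by linarith [hf.1])
  refine ⟨α, M + 1, f.continuous, hf.1, by omega, exp_F1 hf, exp_F2 hf, ?_⟩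
  intro x y w a b c p hp
  have h1 : ∀ (s : ℕ) (u : X) (j : ℕ), zIter f ((s + j : ℕ) : ℤ) (zIter f (-(s : ℤ)) u) =
      (f : X → X)^[j] u := by
    intro s u j
    rw [← zIter_add, ← zIter_nat]
    congr 1
    push_cast; ring
  obtain ⟨z, hz, hsh⟩ := hM 2
    ![x, zIter f (-((a + (M + 1) : ℕ) : ℤ)) y, zIter f (-((a + b + 2 * (M + 1) : ℕ) : ℤ)) w]
    ![0, (a + (M + 1) : ℕ), (a + b + 2 * (M + 1) : ℕ)]
    ![(a : ℕ), (a + (M + 1) + b : ℕ), (a + b + 2 * (M + 1) + c : ℕ)]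
    (by intro i; fin_cases i <;> simp)
    (by intro i; fin_cases i <;> simp <;> omega) p
    (by simp [Fin.last]; omega)
  refine ⟨z, hz, fun j hj => ?_, fun j hj => ?_, fun j hj => ?_⟩
  · have := hsh 0 j (by simp) (by simp; omega)
    simpa [zIter_nat] using this
  · have := hsh 1 ((a + (M + 1) + j : ℕ) : ℤ) (by simp) (by simp; omega)
    simp only [Matrix.cons_val_one, Matrix.cons_val_zero] at this
    rw [h1, zIter_nat] at this
    exact this
  · have := hsh 2 ((a + b + 2 * (M + 1) + j : ℕ) : ℤ) (by simp) (by simp; omega)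
    simp only [Matrix.cons_val] at this
    rw [h1, zIter_nat] at this
    exact this

/-- Number of `n`-periodic points. -/
noncomputable def qn (f : X → X) (n : ℕ) : ℕ := (perSet f n).ncard

/-- Points of `A` are distinguished at scale `r` within time `n`. -/
def SepS (f : X → X) (n : ℕ) (r : ℝ) (A : Set X) : Prop :=
  ∀ x ∈ A, ∀ y ∈ A, (∀ j < n, dist (f^[j] x) (f^[j] y) ≤ r) → x = y

lemma SepS.singleton (f : X → X) (n : ℕ) (r : ℝ) (x : X) : SepS f n r {x} := by
  intro a ha b hb _
  rw [ha, hb]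

lemma SepS.of_isSep {f : X → X} {n : ℕ} {r : ℝ} {A : Set X} (h : IsSep f n r A) :
    SepS f n r A := by
  intro a ha b hb H
  by_contra hne
  obtain ⟨j, hj, hj'⟩ := h ha hb hne
  linarith [H j hj]

lemma SepS.mono {f : X → X} {n : ℕ} {r : ℝ} {A B : Set X} (h : SepS f n r A) (hB : B ⊆ A) :
    SepS f n r B := fun x hx y hy H => h x (hB hx) y (hB hy) H

section
variable {f : X → X} {α : ℝ} {M : ℕ}

lemma Dyn.sepS_per (D : Dyn f α M) {n : ℕ} (hn : 1 ≤ n) : SepS f n (α / 2) (perSet f n) :=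
  fun x hx y hy H => D.F1 n hn x hx y hy fun j hj => (H j hj).trans (by linarith [D.hα])

lemma Dyn.finite_per (D : Dyn f α M) {n : ℕ} (hn : 1 ≤ n) : (perSet f n).Finite := by
  obtain ⟨c, -, hc⟩ := lab_univ f D.hα
  obtain ⟨l, hl⟩ := hc n
  refine Set.Finite.of_finite_image (f := l) (toFinite _) fun x hx y hy hxy => ?_
  exact D.F1 n hn x hx y hy fun j hj => hl x trivial y trivial hxy j hj

lemma Dyn.triple (D : Dyn f α M) {A B C : Set X} {a b c p : ℕ} (hA : SepS f a (α / 2) A)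
    (hB : SepS f b (α / 2) B) (hC : SepS f c (α / 2) C) (hp : a + b + c + 3 * M ≤ p) (S : Set X)
    (hS : ∀ x ∈ A, ∀ y ∈ B, ∀ w ∈ C, ∀ z ∈ perSet f p,
      (∀ j < a, dist (f^[j] z) (f^[j] x) ≤ α / 4) →
      (∀ j < b, dist (f^[a + M + j] z) (f^[j] y) ≤ α / 4) →
      (∀ j < c, dist (f^[a + b + 2 * M + j] z) (f^[j] w) ≤ α / 4) → z ∈ S) :
    A.ncard * B.ncard * C.ncard ≤ (perSet f p ∩ S).ncard := by
  choose φ h1 h2 h3 h4 using fun t : X × X × X => D.F3 t.1 t.2.1 t.2.2 a b c p hp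
  have hM := D.hM
  have := Set.ncard_le_ncard_of_injOn (s := A ×ˢ B ×ˢ C) (t := perSet f p ∩ S) φ
    (fun t ht => ⟨h1 t, hS _ ht.1 _ ht.2.1 _ ht.2.2 _ (h1 t) (h2 t) (h3 t) (h4 t)⟩)
    (by
      rintro ⟨x, y, w⟩ ⟨hx, hy, hw⟩ ⟨x', y', w'⟩ ⟨hx', hy', hw'⟩ he
      have e1 : x = x' := hA x hx x' hx' fun j hj => by
        have u := h2 (x, y, w) j hj
        have v := h2 (x', y', w') j hj
        rw [← he] at v
        simp only at u v
        linarith [dist_triangle_left (f^[j] x) (f^[j] x') (f^[j] (φ (x, y, w)))]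
      have e2 : y = y' := hB y hy y' hy' fun j hj => by
        have u := h3 (x, y, w) j hj
        have v := h3 (x', y', w') j hj
        rw [← he] at v
        simp only at u v
        linarith [dist_triangle_left (f^[j] y) (f^[j] y') (f^[a + M + j] (φ (x, y, w)))]
      have e3 : w = w' := hC w hw w' hw' fun j hj => by
        have u := h4 (x, y, w) j hj
        have v := h4 (x', y', w') j hj
        rw [← he] at v
        simp only at u v
        linarith [dist_triangle_left (f^[j] w) (f^[j] w') (f^[a + b + 2 * M + j] (φ (x, y, w)))]
      rw [e1, e2, e3])
    ((D.finite_per (by omega)).inter_of_left _)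
  rwa [Set.ncard_prod, Set.ncard_prod, ← mul_assoc] at this

lemma Dyn.q_sep (D : Dyn f α M) {A : Set X} {a p : ℕ} (hA : SepS f a (α / 2) A) (hp : a + 3 * M ≤ p) :
    A.ncard ≤ qn f p := by
  rcases A.eq_empty_or_nonempty with rfl | ⟨x, -⟩
  · simp
  have := D.triple hA (SepS.singleton f 0 _ x) (SepS.singleton f 0 _ x) (p := p) (by omega) univ
    (fun _ _ _ _ _ _ _ _ _ _ _ => trivial)
  simpa [qn] using this

lemma Dyn.q_two (D : Dyn f α M) [Nonempty X] {a b p : ℕ} (ha : 1 ≤ a) (hb : 1 ≤ b) (hp : a + b + 3 * M ≤ p) :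
    qn f a * qn f b ≤ qn f p := by
  obtain ⟨x⟩ := ‹Nonempty X›
  have := D.triple (D.sepS_per ha) (D.sepS_per hb) (SepS.singleton f 0 _ x) (p := p) (by omega) univ
    (fun _ _ _ _ _ _ _ _ _ _ _ => trivial)
  simpa [qn] using this

lemma Dyn.q_mono (D : Dyn f α M) {a p : ℕ} (ha : 1 ≤ a) (hp : a + 3 * M ≤ p) :
    qn f a ≤ qn f p := D.q_sep (D.sepS_per ha) hp

lemma Dyn.q_pos (D : Dyn f α M) [Nonempty X] {p : ℕ} (hp : 3 * M ≤ p) : 1 ≤ qn f p := by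
  obtain ⟨x⟩ := ‹Nonempty X›
  have := D.q_sep (SepS.singleton f 0 _ x) (p := p) (by omega)
  simpa using this

lemma Dyn.q_sub (D : Dyn f α M) {a b : ℕ} (hab : 1 ≤ a + b) :
    qn f (a + b) ≤ qn f (a + 3 * M) * qn f (b + 3 * M) := by
  have hM := D.hM
  choose φ h1 h2 _ _ using fun x : X => D.F3 x x x a 0 0 (a + 3 * M) (by omega)
  choose ψ k1 k2 _ _ using fun x : X => D.F3 x x x b 0 0 (b + 3 * M) (by omega)
  have := Set.ncard_le_ncard_of_injOn (s := perSet f (a + b))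
    (t := perSet f (a + 3 * M) ×ˢ perSet f (b + 3 * M)) (fun x => (φ x, ψ (f^[a] x)))
    (fun t _ => ⟨h1 t, k1 _⟩)
    (by
      intro x hx y hy he
      simp only [Prod.mk.injEq] at he
      refine D.sepS_per hab x hx y hy fun j hj => ?_
      rcases lt_or_ge j a with hja | hja
      · have u := h2 x j hja
        have v := h2 y j hja
        rw [← he.1] at v
        linarith [dist_triangle_left (f^[j] x) (f^[j] y) (f^[j] (φ x))]
      · obtain ⟨i, rfl⟩ := Nat.exists_eq_add_of_le hja
        have u := k2 (f^[a] x) i (by omega)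
        have v := k2 (f^[a] y) i (by omega)
        rw [← he.2] at v
        rw [← Function.iterate_add_apply, add_comm i a] at u v
        linarith [dist_triangle_left (f^[a + i] x) (f^[a + i] y) (f^[i] (ψ (f^[a] x)))])
    ((D.finite_per (by omega)).prod (D.finite_per (by omega)))
  rwa [Set.ncard_prod] at this

lemma Dyn.q_sub' (D : Dyn f α M) {s r : ℕ} (hs : 3 * M ≤ s) : qn f (s + r) ≤ qn f s * qn f (r + 6 * M) := by
  have hM := D.hM
  have := D.q_sub (a := s - 3 * M) (b := r + 3 * M) (by omega)
  rwa [show s - 3 * M + (r + 3 * M) = s + r by omega, show s - 3 * M + 3 * M = s by omega,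
    show r + 3 * M + 3 * M = r + 6 * M by omega] at this

lemma Dyn.q_pow (D : Dyn f α M) [Nonempty X] {r : ℕ} (hr : 1 ≤ r) (k : ℕ) :
    qn f r ^ (k + 1) ≤ qn f ((k + 1) * (r + 3 * M)) := by
  induction k with
  | zero => simpa using D.q_mono hr le_rfl
  | succ k ih =>
    rw [pow_succ]
    refine (Nat.mul_le_mul_right _ ih).trans ?_
    refine D.q_two (by nlinarith) hr ?_
    have : (k + 1 + 1) * (r + 3 * M) = (k + 1) * (r + 3 * M) + (r + 3 * M) := by ring
    omega

lemma Dyn.topEntropy_ge (D : Dyn f α M) [Nonempty X] {g h : X → X} (hh : Continuous h)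
    (hsurj : Function.Surjective h) (hsemi : ∀ x, f (h x) = h (g x)) {r : ℕ} (hr : 3 * M ≤ r) :
    ((Real.log (qn f r) / (r + 3 * M : ℕ) : ℝ) : EReal) ≤ topEntropy g := by
  classical
  have hM := D.hM
  obtain ⟨s, hs⟩ := hsurj.hasRightInverse
  obtain ⟨ε, hε, hunif⟩ := Metric.uniformContinuous_iff.mp
    (CompactSpace.uniformContinuous_of_continuous hh) α D.hα
  set n := r + 3 * M with hn
  have hcard : ∀ N, 1 ≤ N → (qn f N : ℝ≥0∞) ≤ sepCard g univ N (ε / 2) := by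
    intro N hN
    have hfin := D.finite_per hN
    have hc : (hfin.toFinset.image s).card = qn f N := by
      rw [Finset.card_image_of_injective _ hs.injective, qn, ncard_eq_toFinset_card _ hfin]
    rw [← hc]
    refine le_iSup₂_of_le (hfin.toFinset.image s) ⟨subset_univ _, ?_⟩ le_rfl
    intro u hu v hv huv
    simp only [Finset.coe_image, Finite.coe_toFinset, mem_image] at hu hv
    obtain ⟨x, hx, rfl⟩ := hu
    obtain ⟨y, hy, rfl⟩ := hv
    by_contra hcon
    push Not at hcon
    apply huv
    congr 1
    refine D.F1 N hN x hx y hy fun j hj => ?_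
    have := hunif (lt_of_le_of_lt (hcon j hj) (by linarith))
    rw [← semiconj_iter hsemi, ← semiconj_iter hsemi, hs, hs] at this
    exact this.le
  unfold topEntropy relEntropy
  refine le_iSup₂_of_le (ε / 2) (by linarith) ?_
  refine le_limsup_of_frequently_le' ?_
  rw [frequently_atTop]
  intro k
  refine ⟨(k + 1) * n, by nlinarith, ?_⟩
  have h1 : ((qn f r ^ (k + 1) : ℕ) : ℝ≥0∞) ≤ sepCard g univ ((k + 1) * n) (ε / 2) :=
    le_trans (by exact_mod_cast D.q_pow (by omega) k) (hcard _ (by nlinarith))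
  have hq := D.q_pos hr
  have h2 : ENNReal.log ((qn f r ^ (k + 1) : ℕ) : ℝ≥0∞) = (((k + 1) * Real.log (qn f r) : ℝ) : EReal) := by
    have hpos : 0 < qn f r ^ (k + 1) := by positivity
    rw [ENNReal.log_pos_real' (ENNReal.toReal_pos (by exact_mod_cast hpos.ne') (by simp))]
    simp
  have hn0 : (0 : ℝ) < n := by have : 0 < n := by omega
                               exact_mod_cast this
  have h3 : ((Real.log (qn f r) / n : ℝ) : EReal) =
      ENNReal.log ((qn f r ^ (k + 1) : ℕ) : ℝ≥0∞) / (((k + 1) * n : ℕ) : EReal) := by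
    rw [h2, show (((k + 1) * n : ℕ) : EReal) = (((k + 1) * n : ℝ) : EReal) by push_cast; rfl,
      ← EReal.coe_div]
    congr 1
    have : (k + 1 : ℝ) ≠ 0 := by positivity
    field_simp
  rw [h3]
  exact EReal.div_le_div_right_of_nonneg (by positivity) (ENNReal.log_monotone h1)

end
end SamvaAux

namespace SamvaAux

variable {X : Type*} [MetricSpace X] [CompactSpace X] [MeasurableSpace X] [BorelSpace X]

lemma map_uniformOn {h : X → X} (hh : Measurable h) {S T : Set X} (hS : MeasurableSet S)
    (hT : MeasurableSet T) (hb : BijOn h S T) :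
    (ProbabilityTheory.uniformOn S).map h = ProbabilityTheory.uniformOn T := by
  ext B hB
  rw [Measure.map_apply hh hB, ProbabilityTheory.uniformOn, ProbabilityTheory.uniformOn,
    ProbabilityTheory.cond_apply hS, ProbabilityTheory.cond_apply hT,
    Measure.count_apply hS, Measure.count_apply hT, Measure.count_apply (hS.inter (hh hB)),
    Measure.count_apply (hT.inter hB), ← hb.image_eq, ← image_inter_preimage,
    hb.injOn.encard_image, (hb.injOn.mono inter_subset_left).encard_image]

lemma uniformOn_real {S : Set X} (hS : S.Finite) {B : Set X} (hB : MeasurableSet B) :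
    (ProbabilityTheory.uniformOn S).real B = (S ∩ B).ncard / S.ncard := by
  have hS' := hS.measurableSet
  rw [measureReal_def, ProbabilityTheory.uniformOn, ProbabilityTheory.cond_apply hS',
    Measure.count_apply hS', Measure.count_apply (hS'.inter hB), ← hS.cast_ncard_eq,
    ← (hS.inter_of_left B).cast_ncard_eq]
  simp [div_eq_inv_mul]

lemma weak_closed {μs : ℕ → Measure X} {μ : Measure X} [IsProbabilityMeasure μ]
    (hμ : WeakLimit μs μ) (N : ℕ) (hp : ∀ n ≥ N, IsProbabilityMeasure (μs n)) {C : Set X}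
    (hC : IsClosed C) {c : ℝ} (hc : ∀ᶠ n in atTop, c ≤ (μs n).real C) : c ≤ μ.real C := by
  set νs : ℕ → ProbabilityMeasure X := fun n => ⟨μs (n + N), hp _ (by omega)⟩ with hνs
  have ht : Tendsto νs atTop (𝓝 (⟨μ, inferInstance⟩ : ProbabilityMeasure X)) := by
    refine ProbabilityMeasure.tendsto_iff_forall_integral_tendsto.mpr fun φ => ?_
    exact (tendsto_add_atTop_iff_nat (f := fun n => ∫ x, φ x ∂(μs n)) N).mpr (hμ φ.toContinuousMap)
  have h1 := ProbabilityMeasure.limsup_measure_closed_le_of_tendsto ht hC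
  rcases le_or_gt c 0 with h0 | h0
  · exact h0.trans measureReal_nonneg
  have h2 : ENNReal.ofReal c ≤ μ C := by
    refine le_trans ?_ h1
    refine le_limsup_of_frequently_le' (Eventually.frequently ?_)
    have := (tendsto_add_atTop_nat N).eventually hc
    filter_upwards [this] with n hn
    rw [ENNReal.ofReal_le_iff_le_toReal]
    · exact hn
    · have := hp (n + N) (by omega)
      exact measure_ne_top (μs (n + N)) C
  rwa [ENNReal.ofReal_le_iff_le_toReal (measure_ne_top _ _)] at h2

lemma weak_open {μs : ℕ → Measure X} {μ : Measure X} [IsProbabilityMeasure μ]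
    (hμ : WeakLimit μs μ) (N : ℕ) (hp : ∀ n ≥ N, IsProbabilityMeasure (μs n)) {U : Set X}
    (hU : IsOpen U) {c : ℝ} (hc : c < μ.real U) : ∀ᶠ n in atTop, c < (μs n).real U := by
  set νs : ℕ → ProbabilityMeasure X := fun n => ⟨μs (n + N), hp _ (by omega)⟩ with hνs
  have ht : Tendsto νs atTop (𝓝 (⟨μ, inferInstance⟩ : ProbabilityMeasure X)) := by
    refine ProbabilityMeasure.tendsto_iff_forall_integral_tendsto.mpr fun φ => ?_
    exact (tendsto_add_atTop_iff_nat (f := fun n => ∫ x, φ x ∂(μs n)) N).mpr (hμ φ.toContinuousMap)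
  have h1 := ProbabilityMeasure.le_liminf_measure_open_of_tendsto ht hU
  rcases lt_or_ge c 0 with h0 | h0
  · exact Eventually.of_forall fun n => h0.trans_le measureReal_nonneg
  have h2 : ENNReal.ofReal c < μ U := by
    rwa [ENNReal.ofReal_lt_iff_lt_toReal h0 (measure_ne_top _ _)]
  have h3 := eventually_lt_of_lt_liminf (h2.trans_le h1)
  obtain ⟨N0, hN0⟩ := eventually_atTop.mp h3
  refine eventually_atTop.mpr ⟨N0 + N, fun n hn => ?_⟩
  have h4 := hN0 (n - N) (by omega)
  have h5 : ENNReal.ofReal c < μs n U := by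
    have e : n - N + N = n := by omega
    simp only [hνs] at h4
    change ENNReal.ofReal c < μs (n - N + N) U at h4
    rwa [e] at h4
  have := hp n (by omega)
  rwa [ENNReal.ofReal_lt_iff_lt_toReal h0 (measure_ne_top _ _)] at h5

lemma bijOn_per (f : X → X) {n : ℕ} (hn : 1 ≤ n) : BijOn f (perSet f n) (perSet f n) := by
  obtain ⟨m, rfl⟩ : ∃ m, n = m + 1 := ⟨n - 1, by omega⟩
  refine ⟨fun x hx => ?_, fun x hx y hy hxy => ?_, fun x hx => ⟨f^[m] x, ?_, ?_⟩⟩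
  · change f^[m + 1] (f x) = f x
    rw [← Function.iterate_succ_apply, Function.iterate_succ_apply']
    exact congrArg f hx
  · have hx' : f^[m + 1] x = x := hx
    have hy' : f^[m + 1] y = y := hy
    rw [← hx', ← hy', Function.iterate_succ_apply, Function.iterate_succ_apply, hxy]
  · change f^[m + 1] (f^[m] x) = f^[m] x
    rw [← Function.iterate_add_apply, add_comm, Function.iterate_add_apply]
    exact congrArg _ hx
  · rw [← Function.iterate_succ_apply' f]; exact hx

/-- Closed Bowen ball. -/
def CB (f : X → X) (n : ℕ) (x : X) (r : ℝ) : Set X :=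
  {z | ∀ j < n, dist (f^[j] z) (f^[j] x) ≤ r}

lemma CB_closed {f : X → X} (hf : Continuous f) (n : ℕ) (x : X) (r : ℝ) :
    IsClosed (CB f n x r) := by
  have e : CB f n x r = ⋂ (j : ℕ) (_ : j < n), {z | dist (f^[j] z) (f^[j] x) ≤ r} := by
    ext z; simp [CB]
  rw [e]
  refine isClosed_iInter fun j => isClosed_iInter fun _ => ?_
  exact isClosed_le ((hf.iterate j).dist continuous_const) continuous_const

section
variable {f : X → X} {α : ℝ} {M : ℕ}

lemma Dyn.perMeasure_real (D : Dyn f α M) {n : ℕ} (hn : 1 ≤ n) {B : Set X} (hB : MeasurableSet B) :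
    (perMeasure f n).real B = (perSet f n ∩ B).ncard / qn f n :=
  uniformOn_real (D.finite_per hn) hB

variable [Nonempty X]

lemma Dyn.perMeasure_prob (D : Dyn f α M) {n : ℕ} (hn : n ≥ 3 * M) : IsProbabilityMeasure (perMeasure f n) := by
  have hM := D.hM
  refine ProbabilityTheory.isProbabilityMeasure_uniformOn (D.finite_per (by omega)) ?_
  refine (Set.ncard_pos (D.finite_per (by omega))).mp (D.q_pos hn)

variable {μ : Measure X} [IsProbabilityMeasure μ]

lemma Dyn.inv (D : Dyn f α M)
    (hμ : WeakLimit (perMeasure f) μ) : MeasurePreserving f μ μ := by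
  have hfm := D.cont.measurable
  refine ⟨hfm, ?_⟩
  have : IsProbabilityMeasure (μ.map f) := Measure.isProbabilityMeasure_map hfm.aemeasurable
  refine ext_of_forall_integral_eq_of_IsFiniteMeasure fun φ => ?_
  rw [integral_map hfm.aemeasurable φ.continuous.aestronglyMeasurable]
  refine tendsto_nhds_unique (hμ ⟨fun x => φ (f x), φ.continuous.comp D.cont⟩) ?_
  refine (hμ φ.toContinuousMap).congr' ?_
  filter_upwards [eventually_ge_atTop 1] with n hn
  have e : (perMeasure f n).map f = perMeasure f n :=
    map_uniformOn hfm (D.finite_per hn).measurableSet (D.finite_per hn).measurableSet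
      (bijOn_per f hn)
  conv_lhs => rw [← e]
  rw [integral_map hfm.aemeasurable]
  · rfl
  · exact φ.continuous.aestronglyMeasurable

lemma Dyn.gibbs (D : Dyn f α M)
    (hμ : WeakLimit (perMeasure f) μ) {n : ℕ} (hn : 3 * M ≤ n) (x : X) :
    1 / ((qn f n : ℝ) * qn f (15 * M)) ≤ μ.real (CB f n x (α / 4)) := by
  have hM := D.hM
  refine weak_closed hμ (3 * M) (fun n hn => D.perMeasure_prob hn) (CB_closed D.cont _ _ _) ?_
  filter_upwards [eventually_ge_atTop (n + 3 * M + 3 * M)] with p hp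
  obtain ⟨N, rfl⟩ : ∃ N, p = n + N + 3 * M := ⟨p - n - 3 * M, by omega⟩
  have hN : 3 * M ≤ N := by omega
  rw [D.perMeasure_real (by omega) (CB_closed D.cont _ _ _).measurableSet]
  have h1 := D.triple (SepS.singleton f n _ x) (D.sepS_per (show 1 ≤ N by omega))
    (SepS.singleton f 0 _ x) (p := n + N + 3 * M) (by omega) (CB f n x (α / 4))
    (by
      intro x' hx' y _ w _ z _ hz _ _
      rw [mem_singleton_iff] at hx'
      subst hx'
      exact hz)
  simp only [ncard_singleton, one_mul, mul_one] at h1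
  have h2 := D.q_sub' (s := n) (r := N + 3 * M) hn
  have h3 := D.q_sub' (s := N) (r := 9 * M) hN
  rw [show n + (N + 3 * M) = n + N + 3 * M by ring,
    show N + 3 * M + 6 * M = N + 9 * M by ring] at h2
  rw [show 9 * M + 6 * M = 15 * M by ring] at h3
  have h4 : qn f (n + N + 3 * M) ≤ qn f n * (qn f N * qn f (15 * M)) :=
    h2.trans (Nat.mul_le_mul_left _ h3)
  have p1 := D.q_pos hn
  have p2 := D.q_pos (show 3 * M ≤ 15 * M by omega)
  have p3 := D.q_pos (show 3 * M ≤ n + N + 3 * M by omega)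
  have p1' : (0 : ℝ) < qn f n := by exact_mod_cast p1
  have p2' : (0 : ℝ) < qn f (15 * M) := by exact_mod_cast p2
  have p3' : (0 : ℝ) < qn f (n + N + 3 * M) := by exact_mod_cast p3
  have h4' : (qn f (n + N + 3 * M) : ℝ) ≤ qn f n * (qn f N * qn f (15 * M)) := by exact_mod_cast h4
  have h1' : (qn f N : ℝ) ≤ ((perSet f (n + N + 3 * M) ∩ CB f n x (α / 4)).ncard : ℝ) := by
    exact_mod_cast h1
  rw [div_le_div_iff₀ (by positivity) p3']
  nlinarith [mul_le_mul_of_nonneg_left h1' (mul_pos p1' p2').le]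

end
end SamvaAux

namespace SamvaAux

variable {X : Type*} [MetricSpace X] [CompactSpace X] [MeasurableSpace X] [BorelSpace X]

lemma exists_K (μ : Measure X) [IsProbabilityMeasure μ] {A : Set X} (hA : MeasurableSet A)
    (h0 : μ A ≠ 0) : ∃ K ⊆ A, IsCompact K ∧ 0 < μ.real K := by
  obtain ⟨K, hKA, hK, hpos⟩ := hA.exists_lt_isCompact (pos_iff_ne_zero.mpr h0)
  exact ⟨K, hKA, hK, ENNReal.toReal_pos hpos.ne' (measure_ne_top _ _)⟩

lemma exists_U (μ : Measure X) [IsProbabilityMeasure μ] {K : Set X} (hK : IsCompact K)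
    {τ : ℝ} (hτ : 0 < τ) : ∃ U, IsOpen U ∧ K ⊆ U ∧ μ.real U < μ.real K + τ ∧
      ∃ ρ > 0, Metric.cthickening ρ K ⊆ U := by
  obtain ⟨U, hKU, hU, hlt⟩ := K.exists_isOpen_lt_add (μ := μ) (measure_ne_top _ _)
    (ε := ENNReal.ofReal τ) (by simpa using hτ)
  obtain ⟨ρ, hρ, hsub⟩ := hK.exists_cthickening_subset_open hU hKU
  refine ⟨U, hU, hKU, ?_, ρ, hρ, hsub⟩
  have := (ENNReal.toReal_lt_toReal (measure_ne_top _ _)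
    (ENNReal.add_ne_top.mpr ⟨measure_ne_top _ _, by simp⟩)).mpr hlt
  rwa [ENNReal.toReal_add (measure_ne_top _ _) (by simp), ENNReal.toReal_ofReal hτ.le] at this

section
variable {f : X → X} {α : ℝ} {M : ℕ}
variable [Nonempty X]
variable {μ : Measure X} [IsProbabilityMeasure μ]

lemma Dyn.half (D : Dyn f α M)
    (hμ : WeakLimit (perMeasure f) μ) {K : Set X} (hpos : 0 < μ.real K) {ρ : ℝ} (hρ : 0 < ρ) (l : ℕ) :
    ∀ᶠ s in atTop, μ.real K / 2 * qn f s ≤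
      ((perSet f s ∩ f^[l] ⁻¹' (Metric.thickening ρ K)).ncard : ℝ) := by
  have hM := D.hM
  have hopen : IsOpen (f^[l] ⁻¹' (Metric.thickening ρ K)) :=
    Metric.isOpen_thickening.preimage (D.cont.iterate l)
  have h1 : μ.real K / 2 < μ.real (f^[l] ⁻¹' (Metric.thickening ρ K)) := by
    rw [((D.inv hμ).iterate l).measureReal_preimage
      Metric.isOpen_thickening.measurableSet.nullMeasurableSet]
    have := measureReal_mono (μ := μ) (Metric.self_subset_thickening hρ K)
    linarith
  filter_upwards [weak_open hμ (3 * M) (fun n hn => D.perMeasure_prob hn) hopen h1,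
    eventually_ge_atTop (3 * M)] with s hs hs'
  rw [D.perMeasure_real (by omega) hopen.measurableSet] at hs
  have p : (0 : ℝ) < qn f s := by exact_mod_cast D.q_pos hs'
  rw [lt_div_iff₀ p] at hs
  exact hs.le

lemma Dyn.ergodic (D : Dyn f α M)
    (hμ : WeakLimit (perMeasure f) μ) : Ergodic f μ := by
  have hM := D.hM
  have hinvμ := D.inv hμ
  refine ⟨hinvμ, ⟨fun A hA hinv => ?_⟩⟩
  rw [eventuallyConst_set']
  by_contra hcon
  push Not at hcon
  obtain ⟨hc1, hc2⟩ := hcon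
  have h1 : μ A ≠ 0 := fun h => hc1 (ae_eq_empty.mpr h)
  have h2 : μ Aᶜ ≠ 0 := fun h => hc2 (ae_eq_univ.mpr h)
  obtain ⟨K, hKA, hK, ha⟩ := exists_K μ hA h1
  obtain ⟨L, hLA, hL, hb⟩ := exists_K μ hA.compl h2
  set a := μ.real K with hadef
  set b := μ.real L with hbdef
  obtain ⟨Q, hQ⟩ : ∃ Q : ℝ, Q = qn f (21 * M) := ⟨_, rfl⟩
  have pQ : 0 < Q := by rw [hQ]; exact_mod_cast D.q_pos (by omega)
  set τ := a * b / (16 * Q) with hτ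
  have hτ0 : 0 < τ := by positivity
  obtain ⟨U, hU, hKU, hUτ, ρ₁, hρ₁, hsU⟩ := exists_U μ hK hτ0
  obtain ⟨V, hV, hLV, hVτ, ρ₂, hρ₂, hsV⟩ := exists_U μ hL hτ0
  set ρ := min ρ₁ ρ₂ with hρdef
  have hρ : 0 < ρ := lt_min hρ₁ hρ₂
  obtain ⟨l, hl⟩ := D.F2 (ρ / 2) (by linarith)
  obtain ⟨s, hs1, hs2, hs3, hs4⟩ := ((D.half hμ ha (half_pos hρ) l).and
    ((D.half hμ hb (half_pos hρ) l).and ((eventually_ge_atTop (3 * M)).and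
      (eventually_ge_atTop (2 * l + 1))))).exists
  set A' := perSet f s ∩ f^[l] ⁻¹' (Metric.thickening (ρ / 2) K) with hA'
  set B' := perSet f s ∩ f^[l] ⁻¹' (Metric.thickening (ρ / 2) L) with hB'
  set S := f^[l] ⁻¹' (Metric.cthickening ρ K) ∩ f^[s + M + l] ⁻¹' (Metric.cthickening ρ L) with hS
  have hSc : IsClosed S := (Metric.isClosed_cthickening.preimage (D.cont.iterate l)).inter
    (Metric.isClosed_cthickening.preimage (D.cont.iterate _))
  have hclose : ∀ (C : Set X) (u v : X), f^[l] v ∈ Metric.thickening (ρ / 2) C →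
      (∀ j < s, dist (f^[j] u) (f^[j] v) ≤ α / 4) → f^[l] u ∈ Metric.cthickening ρ C := by
    intro C u v hv huv
    apply Metric.thickening_subset_cthickening
    rw [Metric.mem_thickening_iff] at hv ⊢
    obtain ⟨c, hc, hvc⟩ := hv
    refine ⟨c, hc, ?_⟩
    have := hl u v fun j hj => (huv j (by omega)).trans (by linarith [D.hα])
    linarith [dist_triangle (f^[l] u) (f^[l] v) c]
  have hlow : a * b / (4 * Q) ≤ μ.real S := by
    refine weak_closed hμ (3 * M) (fun n hn => D.perMeasure_prob hn) hSc ?_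
    filter_upwards [eventually_ge_atTop (2 * s + 3 * M + 3 * M)] with p hp
    obtain ⟨N, rfl⟩ : ∃ N, p = s + s + N + 3 * M := ⟨p - 2 * s - 3 * M, by omega⟩
    have hN : 3 * M ≤ N := by omega
    rw [D.perMeasure_real (by omega) hSc.measurableSet]
    have ht := D.triple ((D.sepS_per (show 1 ≤ s by omega)).mono (B := A') inter_subset_left)
      ((D.sepS_per (show 1 ≤ s by omega)).mono (B := B') inter_subset_left)
      (D.sepS_per (show 1 ≤ N by omega)) (p := s + s + N + 3 * M) le_rfl S
      (by
        intro x hx y hy w _ z _ hz1 hz2 _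
        refine ⟨hclose K z x hx.2 hz1, ?_⟩
        have := hclose L (f^[s + M] z) y hy.2 (fun j hj => by
          have := hz2 j hj
          rwa [add_comm (s + M) j, Function.iterate_add_apply] at this)
        rw [← Function.iterate_add_apply, add_comm l] at this
        exact this)
    have g1 := D.q_sub' (s := s) (r := s + N + 3 * M) hs3
    have g2 := D.q_sub' (s := s) (r := N + 9 * M) hs3
    have g3 := D.q_sub' (s := N) (r := 15 * M) hN
    rw [show s + (s + N + 3 * M) = s + s + N + 3 * M by ring,
      show s + N + 3 * M + 6 * M = s + (N + 9 * M) by ring] at g1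
    rw [show N + 9 * M + 6 * M = N + 15 * M by ring] at g2
    rw [show 15 * M + 6 * M = 21 * M by ring] at g3
    have g4 : qn f (s + s + N + 3 * M) ≤ qn f s * (qn f s * (qn f N * qn f (21 * M))) :=
      g1.trans (Nat.mul_le_mul_left _ (g2.trans (Nat.mul_le_mul_left _ g3)))
    have g4' : (qn f (s + s + N + 3 * M) : ℝ) ≤ qn f s * (qn f s * (qn f N * Q)) := by
      rw [hQ]; exact_mod_cast g4
    have p3 : (0 : ℝ) < qn f (s + s + N + 3 * M) := by
      exact_mod_cast D.q_pos (show 3 * M ≤ s + s + N + 3 * M by omega)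
    have ht' : (A'.ncard : ℝ) * B'.ncard * qn f N ≤
        ((perSet f (s + s + N + 3 * M) ∩ S).ncard : ℝ) := by
      exact_mod_cast ht
    have hab : (a / 2 * qn f s) * (b / 2 * qn f s) * qn f N ≤ (A'.ncard : ℝ) * B'.ncard * qn f N := by
      gcongr
    rw [le_div_iff₀ p3]
    refine le_trans ?_ (hab.trans ht')
    rw [div_mul_eq_mul_div, div_le_iff₀ (by positivity)]
    have := mul_le_mul_of_nonneg_left g4' (mul_pos ha hb).le
    linarith
  have hup : μ.real S ≤ 2 * τ := by
    have hit : ∀ k, f^[k] ⁻¹' A = A := fun k => by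
      induction k with
      | zero => rfl
      | succ k ih => rw [Function.iterate_succ, preimage_comp, ih, hinv]
    have hsub : S ⊆ f^[l] ⁻¹' (U \ K) ∪ f^[s + M + l] ⁻¹' (V \ L) := by
      rintro z ⟨hz1, hz2⟩
      by_cases hzA : z ∈ A
      · right
        refine ⟨hsV (Metric.cthickening_mono (min_le_right _ _) _ hz2), fun hzL => ?_⟩
        rw [← hit (s + M + l)] at hzA
        exact hLA hzL hzA
      · left
        refine ⟨hsU (Metric.cthickening_mono (min_le_left _ _) _ hz1), fun hzK => ?_⟩
        rw [← hit l] at hzA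
        exact hzA (hKA hzK)
    have k1 := measureReal_mono (μ := μ) hsub
    have k2 := measureReal_union_le (μ := μ) (f^[l] ⁻¹' (U \ K)) (f^[s + M + l] ⁻¹' (V \ L))
    rw [(hinvμ.iterate l).measureReal_preimage
        (hU.measurableSet.diff hK.measurableSet).nullMeasurableSet,
      (hinvμ.iterate _).measureReal_preimage
        (hV.measurableSet.diff hL.measurableSet).nullMeasurableSet,
      measureReal_sdiff hKU hK.measurableSet, measureReal_sdiff hLV hL.measurableSet] at k2
    linarith
  have e : a * b / (4 * Q) = 4 * τ := by rw [hτ]; field_simp; ring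
  linarith

lemma Dyn.ac (D : Dyn f α M)
    (hμ : WeakLimit (perMeasure f) μ) {m : Measure X} [IsProbabilityMeasure m] (hm : MeasurePreserving f m m)
    (hent : ∀ r ≥ 3 * M, ∀ (k : ℕ) (d : X → Fin k), MeasF d →
      (∀ y y', d y = d y' → ∀ j < r + 3 * M, dist (f^[j] y) (f^[j] y') ≤ α) →
      Real.log (qn f r) ≤ HH m d) : m ≪ μ := by
  classical
  have hM := D.hM
  have hα := D.hα
  have hinvμ := D.inv hμ
  refine Measure.AbsolutelyContinuous.mk fun A hA hA0 => ?_
  by_contra hmA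
  obtain ⟨K, hKA, hK, hβ⟩ := exists_K m hA hmA
  have hK0 : μ.real K = 0 := by
    rw [measureReal_def, measure_mono_null hKA hA0]; rfl
  set β := m.real K with hβdef
  have q9 : (1 : ℝ) ≤ qn f (9 * M) := by exact_mod_cast D.q_pos (by omega)
  have q15 : (1 : ℝ) ≤ qn f (15 * M) := by exact_mod_cast D.q_pos (by omega)
  have l9 := Real.log_nonneg q9
  have l15 := Real.log_nonneg q15
  set W : ℝ := 3 + Real.log (qn f (15 * M)) + 2 * Real.log (qn f (9 * M)) with hW
  set θ : ℝ := Real.exp (-(W / β)) with hθ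
  have hθ0 : 0 < θ := Real.exp_pos _
  have hlogθ : Real.log θ = -(W / β) := Real.log_exp _
  obtain ⟨U, hU, hKU, hUθ, ρ, hρ, hsU⟩ := exists_U μ hK hθ0
  rw [hK0, zero_add] at hUθ
  obtain ⟨l, hl⟩ := D.F2 ρ hρ
  set r := 3 * M + 2 * l + 1 with hr
  set n := r + 3 * M with hn
  obtain ⟨E, -, hEsep, hEspan⟩ := exists_max_sep f univ n (ε := α / 2) (by linarith)
    (qn f (n + 3 * M)) (fun E _ hE => by
      have := D.q_sep (SepS.of_isSep hE) (p := n + 3 * M) le_rfl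
      rwa [ncard_coe_finset] at this)
  have hEcard : E.card ≤ qn f (n + 3 * M) := by
    have := D.q_sep (SepS.of_isSep hEsep) (p := n + 3 * M) le_rfl
    rwa [ncard_coe_finset] at this
  set e : Fin E.card → X := fun i => (E.equivFin.symm i : X) with he
  have heE : ∀ i, e i ∈ E := fun i => (E.equivFin.symm i).2
  have heinj : Function.Injective e :=
    Subtype.val_injective.comp E.equivFin.symm.injective
  have hex : ∀ x : X, ∃ i, x ∈ CB f n (e i) (α / 2) := by
    intro x
    obtain ⟨y, hy, hxy⟩ := hEspan x trivial
    refine ⟨E.equivFin ⟨y, hy⟩, ?_⟩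
    simpa [he, CB] using hxy
  have hfind : ∀ x : X, ∃ i, x ∈ CB f n (e i) (α / 2) ∧ ∀ j < i, x ∉ CB f n (e j) (α / 2) := by
    intro x
    obtain ⟨i, hi, hmin⟩ := WellFounded.has_min (wellFounded_lt (α := Fin E.card))
      {i | x ∈ CB f n (e i) (α / 2)} (hex x)
    exact ⟨i, hi, fun j hj hxj => hmin j hxj hj⟩
  choose d hd1 hd2 using hfind
  have hdpre : ∀ i, d ⁻¹' {i} = CB f n (e i) (α / 2) \ ⋃ j, ⋃ (_ : j < i), CB f n (e j) (α / 2) := by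
    intro i
    ext x
    simp only [mem_preimage, mem_singleton_iff, Set.mem_sdiff, mem_iUnion, not_exists]
    constructor
    · rintro rfl
      exact ⟨hd1 x, fun j hj => hd2 x j hj⟩
    · rintro ⟨h1, h2⟩
      rcases lt_trichotomy (d x) i with h | h | h
      · exact absurd (hd1 x) (h2 _ h)
      · exact h
      · exact absurd h1 (hd2 x i h)
  have hCm : ∀ i t, MeasurableSet (CB f n (e i) t) := fun i t => (CB_closed D.cont _ _ _).measurableSet
  have hdm : MeasF d := by
    intro i
    rw [hdpre]
    exact (hCm i _).diff (MeasurableSet.iUnion fun j => MeasurableSet.iUnion fun _ => hCm j _)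
  have hH := hent r (by omega) _ d hdm (by
    intro y y' hyy j hj
    have u := hd1 y j hj
    have v := hd1 y' j hj
    rw [← hyy] at v
    linarith [dist_triangle_right (f^[j] y) (f^[j] y') (f^[j] (e (d y)))])
  set S1 : Finset (Fin E.card) :=
    Finset.univ.filter (fun i => ∃ y, y ∈ CB f n (e i) (α / 2) ∧ f^[l] y ∈ K) with hS1
  have pn : (1 : ℝ) ≤ qn f n := by exact_mod_cast D.q_pos (by omega)
  have hS1card : (S1.card : ℝ) ≤ θ * (qn f n * qn f (15 * M)) := by
    have hdisj : (S1 : Set (Fin E.card)).PairwiseDisjoint fun i => CB f n (e i) (α / 4) := by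
      intro i _ j _ hij
      refine Set.disjoint_left.mpr fun z hzi hzj => ?_
      obtain ⟨t, ht, ht'⟩ := hEsep (heE i) (heE j) (fun h => hij (heinj h))
      linarith [dist_triangle_left (f^[t] (e i)) (f^[t] (e j)) (f^[t] z), hzi t ht, hzj t ht]
    have h1 := measureReal_biUnion_finset (μ := μ) hdisj (fun i _ => hCm i _)
    have h2 : (⋃ i ∈ S1, CB f n (e i) (α / 4)) ⊆ f^[l] ⁻¹' U := by
      refine iUnion₂_subset fun i hi z hz => ?_
      rw [hS1, Finset.mem_filter] at hi
      obtain ⟨-, y, hy, hyK⟩ := hi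
      have := hl z y fun j hj => by
        have u := hz j (by omega)
        have v := hy j (by omega)
        linarith [dist_triangle_right (f^[j] z) (f^[j] y) (f^[j] (e i))]
      exact hsU (Metric.thickening_subset_cthickening _ _
        (Metric.mem_thickening_iff.mpr ⟨_, hyK, this⟩))
    have h3 := measureReal_mono (μ := μ) h2
    rw [h1, (hinvμ.iterate l).measureReal_preimage hU.measurableSet.nullMeasurableSet] at h3
    have h4 : (S1.card : ℝ) * (1 / ((qn f n : ℝ) * qn f (15 * M))) ≤
        ∑ i ∈ S1, μ.real (CB f n (e i) (α / 4)) := by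
      rw [← nsmul_eq_mul]
      exact Finset.card_nsmul_le_sum _ _ _ fun i _ => D.gibbs hμ (by omega) (e i)
    have h5 := (h4.trans h3).trans hUθ.le
    rwa [mul_one_div, div_le_iff₀ (by positivity)] at h5
  have hS2card : ((S1ᶜ).card : ℝ) ≤ qn f n * qn f (9 * M) := by
    have h1 : (S1ᶜ).card ≤ E.card := (Finset.card_le_univ _).trans (by simp)
    have h2 := D.q_sub' (s := n) (r := 3 * M) (by omega)
    rw [show 3 * M + 6 * M = 9 * M by ring] at h2
    exact_mod_cast h1.trans (hEcard.trans h2)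
  set R : Fin E.card → ℝ := fun i => m.real (d ⁻¹' {i}) with hR
  have hR0 : ∀ i, 0 ≤ R i := fun i => measureReal_nonneg
  set p1 := ∑ i ∈ S1, R i with hp1
  set p2 := ∑ i ∈ S1ᶜ, R i with hp2
  have hp12 : p1 + p2 = 1 := by
    rw [hp1, hp2, Finset.sum_add_sum_compl]
    exact fib_one m hdm
  have hp1n : 0 ≤ p1 := Finset.sum_nonneg fun i _ => hR0 i
  have hp2n : 0 ≤ p2 := Finset.sum_nonneg fun i _ => hR0 i
  have hβp1 : β ≤ p1 := by
    rw [hp1, hS1, ← fib m hdm, hβdef, ← (hm.iterate l).measureReal_preimage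
      hK.measurableSet.nullMeasurableSet]
    exact measureReal_mono fun y hy => ⟨y, hd1 y, hy⟩
  have hHH : HH m d = ∑ i ∈ S1, Real.negMulLog (R i) + ∑ i ∈ S1ᶜ, Real.negMulLog (R i) := by
    rw [Finset.sum_add_sum_compl]; rfl
  have b1 := sum_negMulLog_le S1 R (fun i _ => hR0 i) _ hS1card
  have b2 := sum_negMulLog_le S1ᶜ R (fun i _ => hR0 i) _ hS2card
  have c1 : Real.negMulLog p1 ≤ 1 := by
    have := negMulLog_le_aux hp1n (zero_le_one (α := ℝ)) (by simp)
    simp at this; linarith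
  have c2 : Real.negMulLog p2 ≤ 1 := by
    have := negMulLog_le_aux hp2n (zero_le_one (α := ℝ)) (by simp)
    simp at this; linarith
  rw [Real.log_mul hθ0.ne' (by positivity), Real.log_mul (by positivity) (by positivity)] at b1
  rw [Real.log_mul (by positivity) (by positivity)] at b2
  have hqn : Real.log (qn f n) ≤ Real.log (qn f r) + Real.log (qn f (9 * M)) := by
    have h2 := D.q_sub' (s := r) (r := 3 * M) (by omega)
    rw [show 3 * M + 6 * M = 9 * M by ring] at h2
    have pr : (1 : ℝ) ≤ qn f r := by exact_mod_cast D.q_pos (by omega)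
    rw [← Real.log_mul (by positivity) (by positivity)]
    exact Real.log_le_log (by positivity) (by exact_mod_cast h2)
  have hW0 : 0 < W := by linarith
  have hp1θ : p1 * Real.log θ ≤ -W := by
    rw [hlogθ, mul_neg, neg_le_neg_iff, mul_div_assoc', le_div_iff₀ hβ, mul_comm]
    exact mul_le_mul_of_nonneg_right hβp1 hW0.le
  have x1 : p1 * Real.log (qn f (15 * M)) ≤ Real.log (qn f (15 * M)) :=
    mul_le_of_le_one_left l15 (by linarith)
  have x2 : p2 * Real.log (qn f (9 * M)) ≤ Real.log (qn f (9 * M)) :=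
    mul_le_of_le_one_left l9 (by linarith)
  have x3 : p1 * Real.log (qn f n) + p2 * Real.log (qn f n) = Real.log (qn f n) := by
    rw [← add_mul, hp12, one_mul]
  rw [hHH] at hH
  rw [mul_add, mul_add] at b1
  rw [mul_add] at b2
  linarith

end
end SamvaAux

namespace SamvaAux

variable {X : Type*} [MetricSpace X] [CompactSpace X] [MeasurableSpace X] [BorelSpace X]

lemma lift_unique {h : X → X} (hh : Continuous h) (hsurj : Function.Surjective h)
    {μ η ν : Measure X} [IsProbabilityMeasure μ] [IsProbabilityMeasure η] [IsProbabilityMeasure ν]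
    (hη : η.map h = μ) (hν : ν.map h = μ) (H3 : HypH3 h μ) : η = ν := by
  set T : Set X := {y : X | ∃ x : X, h ⁻¹' {y} = {x}} with hT
  have hTc : Tᶜ = ⋃ n : ℕ, (fun p : X × X => h p.1) ''
      {p : X × X | h p.1 = h p.2 ∧ 1 / ((n : ℝ) + 1) ≤ dist p.1 p.2} := by
    ext y
    simp only [mem_compl_iff, mem_iUnion, mem_image]
    constructor
    · intro hy
      obtain ⟨x, rfl⟩ := hsurj y
      have : ∃ x', h x' = h x ∧ x' ≠ x := by
        by_contra hcon
        push Not at hcon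
        exact hy ⟨x, by ext z; exact ⟨fun hz => hcon z hz, fun hz => by rw [hz]; rfl⟩⟩
      obtain ⟨x', hx', hne⟩ := this
      obtain ⟨n, hn⟩ := exists_nat_one_div_lt (dist_pos.mpr hne.symm)
      exact ⟨n, (x, x'), ⟨hx'.symm, hn.le⟩, rfl⟩
    · rintro ⟨n, ⟨x, x'⟩, ⟨h1, h2⟩, rfl⟩ ⟨w, hw⟩
      have e1 : x = w := by
        have : x ∈ h ⁻¹' {h x} := rfl
        rw [hw] at this; exact this
      have e2 : x' = w := by
        have : x' ∈ h ⁻¹' {h x} := h1.symm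
        rw [hw] at this; exact this
      simp only [e1, e2, dist_self] at h2
      have : (0 : ℝ) < 1 / ((n : ℝ) + 1) := by positivity
      linarith
  have hTm : MeasurableSet Tᶜ := by
    rw [hTc]
    refine MeasurableSet.iUnion fun n => ?_
    have hcl : IsClosed {p : X × X | h p.1 = h p.2 ∧ 1 / ((n : ℝ) + 1) ≤ dist p.1 p.2} :=
      (isClosed_eq (hh.comp continuous_fst) (hh.comp continuous_snd)).inter
        (isClosed_le continuous_const (continuous_fst.dist continuous_snd))
    exact (hcl.isCompact.image (hh.comp continuous_fst)).measurableSet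
  have hT0 : μ Tᶜ = 0 := by
    rw [prob_compl_eq_zero_iff hTm.of_compl]; exact H3
  have key : ∀ κ : Measure X, κ.map h = μ → ∀ B : Set X, IsClosed B → κ B = μ (h '' B) := by
    intro κ hκ B hB
    have hBm : MeasurableSet (h '' B) := (hB.isCompact.image hh).measurableSet
    rw [← hκ, Measure.map_apply hh.measurable hBm]
    refine le_antisymm (measure_mono (subset_preimage_image h B)) ?_
    have hsub : h ⁻¹' (h '' B) ⊆ B ∪ h ⁻¹' Tᶜ := by
      rintro x ⟨b, hb, hbx⟩
      by_cases hx : h x ∈ T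
      · left
        obtain ⟨w, hw⟩ := hx
        have e1 : x ∈ h ⁻¹' {h x} := rfl
        have e2 : b ∈ h ⁻¹' {h x} := hbx
        rw [hw, mem_singleton_iff] at e1 e2
        rw [e1, ← e2]; exact hb
      · right; exact hx
    refine (measure_mono hsub).trans ((measure_union_le _ _).trans ?_)
    rw [← Measure.map_apply hh.measurable hTm, hκ, hT0, add_zero]
  refine ext_of_generate_finite {s | IsClosed s}
    (by rw [← borel_eq_generateFrom_isClosed]; exact BorelSpace.measurable_eq) isPiSystem_isClosed
    (fun B hB => ?_) (by simp)
  rw [key η hη B hB, key ν hν B hB]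

lemma main_aux (f g : X ≃ₜ X) (h : X → X) (hcont : Continuous h) (hsurj : Function.Surjective h)
    (hsemi : ∀ x : X, f (h x) = h (g x))
    (hexp : IsExpansive f) (hspec : HasSpecification f)
    (μ : Measure X) (hμprob : IsProbabilityMeasure μ)
    (hμ : WeakLimit (perMeasure (⇑f)) μ)
    (H1 : HypH1 (⇑g) h) (H3 : HypH3 h μ)
    (P : ℕ → Set X) (hP : IsPerSelection (⇑f) (⇑g) h P)
    (ν : Measure X) (hν : WeakClusterPt (fun n => unifMeasure (P n)) ν)
    (η : Measure X) (hηprob : IsProbabilityMeasure η) (hηinv : Measure.map (⇑g) η = η)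
    (hηmax : mEntropy (⇑g) η = topEntropy (⇑g)) : η = ν := by
  have : Nonempty X := nonempty_of_isProbabilityMeasure μ
  obtain ⟨α, M, D⟩ := exists_dyn hexp hspec
  have hM := D.hM
  have hgm : MeasurePreserving g η η := ⟨g.continuous.measurable, hηinv⟩
  have hhm := hcont.measurable
  have hfm := f.continuous.measurable
  have hK : ∀ y, relEntropy g (h ⁻¹' {y}) = 0 := fun y => by
    obtain ⟨x, rfl⟩ := hsurj y
    exact H1 x
  have hmp : IsProbabilityMeasure (η.map h) := Measure.isProbabilityMeasure_map hhm.aemeasurable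
  have hm : MeasurePreserving f (η.map h) (η.map h) := by
    refine ⟨hfm, ?_⟩
    rw [Measure.map_map hfm hhm]
    conv_rhs => rw [← hηinv, Measure.map_map hhm g.continuous.measurable]
    congr 1
    funext x
    exact hsemi x
  have hac : η.map h ≪ μ := by
    refine D.ac hμ hm fun r hr k d hd hdα => ?_
    have h1 := D.topEntropy_ge hcont hsurj hsemi hr
    have h2 := mEntropy_le η hgm hhm hsemi
      (fun ε hε δ hδ => lab_expansive g.continuous hcont hsemi hK D.F2 hε hδ) hd
      (n := r + 3 * M) (by omega) hdα
    rw [hηmax] at h2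
    have h3 := EReal.coe_le_coe_iff.mp (h1.trans h2)
    have hpos : (0 : ℝ) < (r + 3 * M : ℕ) := by
      have : 0 < r + 3 * M := by omega
      exact_mod_cast this
    rwa [div_le_div_iff_of_pos_right hpos] at h3
  have hmμ : η.map h = μ := (D.ergodic hμ).eq_of_absolutelyContinuous hm hac
  obtain ⟨u, hu, hlim⟩ := hν
  have hint : ∀ φ : C(X, ℝ), ∫ x, φ (h x) ∂ν = ∫ x, φ x ∂μ := by
    intro φ
    have h1 := hlim ⟨fun x => φ (h x), φ.continuous.comp hcont⟩
    have h2 := (hμ φ).comp hu.tendsto_atTop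
    refine tendsto_nhds_unique h1 (h2.congr' ?_)
    filter_upwards [hu.tendsto_atTop.eventually (eventually_ge_atTop 1)] with n hn
    have hb := (hP (u n)).2.2
    have hfin := D.finite_per hn
    have hfin' : (P (u n)).Finite := Set.Finite.of_finite_image (by rwa [hb.image_eq]) hb.injOn
    have e : (unifMeasure (P (u n))).map h = perMeasure f (u n) :=
      map_uniformOn hhm hfin'.measurableSet hfin.measurableSet hb
    simp only [Function.comp]
    rw [← e, integral_map hhm.aemeasurable φ.continuous.aestronglyMeasurable]
    rfl
  have hνprob : IsProbabilityMeasure ν := by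
    have := hint (ContinuousMap.const X 1)
    simp only [ContinuousMap.const_apply, integral_const, smul_eq_mul, mul_one,
      probReal_univ] at this
    refine ⟨?_⟩
    rwa [measureReal_def, ENNReal.toReal_eq_one_iff] at this
  have hνμ : ν.map h = μ := by
    have : IsProbabilityMeasure (ν.map h) := Measure.isProbabilityMeasure_map hhm.aemeasurable
    refine ext_of_forall_integral_eq_of_IsFiniteMeasure fun φ => ?_
    rw [integral_map hhm.aemeasurable φ.continuous.aestronglyMeasurable]
    exact hint φ.toContinuousMap
  exact lift_unique hcont hsurj hmμ hνμ H3

end SamvaAux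

/-- Under (H1), (H2), (H3), any `g`-invariant probability measure `η` of maximal entropy is
absolutely continuous with respect to the accumulation point `ν` of `(ν_n)`, and in fact
equals `ν`. -/
theorem maximal_entropy_measure_eq
    {X : Type*} [MetricSpace X] [CompactSpace X] [MeasurableSpace X] [BorelSpace X]
    (f g : X ≃ₜ X) (h : X → X) (hcont : Continuous h) (hsurj : Function.Surjective h)
    (hsemi : ∀ x : X, f (h x) = h (g x))
    (hexp : IsExpansive f) (hspec : HasSpecification f)
    (μ : Measure X) (hμprob : IsProbabilityMeasure μ)
    (hμ : WeakLimit (perMeasure (⇑f)) μ)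
    (H1 : HypH1 (⇑g) h) (H2 : HypH2 (⇑f) (⇑g) h) (H3 : HypH3 h μ)
    (P : ℕ → Set X) (hP : IsPerSelection (⇑f) (⇑g) h P)
    (ν : Measure X) (hν : WeakClusterPt (fun n => unifMeasure (P n)) ν)
    (η : Measure X) (hηprob : IsProbabilityMeasure η) (hηinv : Measure.map (⇑g) η = η)
    (hηmax : mEntropy (⇑g) η = topEntropy (⇑g)) :
    η ≪ ν ∧ η = ν := by
  have key := SamvaAux.main_aux f g h hcont hsurj hsemi hexp hspec μ hμprob hμ H1 H3 P hP ν hν η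
    hηprob hηinv hηmax
  refine ⟨?_, key⟩
  rw [key]
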